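/- Let S = {(0,0),(0,2),(0,4),(0,5),(1,0),(1,1),(1,5),(2,1),(2,2),(2,5),(3,1),(3,3),(3,4),(4,0),(4,5),(5,0),(5,2),(5,4),(5,5)} ⊆ ℕ×ℕ. The generalised toric code C_S over the field with 8 elements has minimum distance exactly 21: every nonzero codeword of C_S has Hamming weight at least 21, and some codeword of C_S has Hamming weight exactly 21. -/

import Mathlib

/-- `F8` is the finite field with 8 elements, `GF(2,3)`. -/
abbrev F8 : Type := GaloisField 2 3

/-- The evaluation vector of an exponent pair `(a, b)`: the function
`F8ˣ × F8ˣ → F8` sending `(x, y)` to `x ^ a * y ^ b`. -/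
noncomputable def evalVec (ab : ℕ × ℕ) : F8ˣ × F8ˣ → F8 :=
  fun xy => (xy.1 : F8) ^ ab.1 * (xy.2 : F8) ^ ab.2

/-- The Hamming weight of a vector `c : F8ˣ × F8ˣ → F8`: the number of
coordinates at which `c` is nonzero. -/
noncomputable def hammingWeight (c : F8ˣ × F8ˣ → F8) : ℕ :=
  Nat.card {p : F8ˣ × F8ˣ // c p ≠ 0}

/-- The set of exponent vectors. -/
def S : Set (ℕ × ℕ) := {(0,0),(0,2),(0,4),(0,5),(1,0),(1,1),(1,5),(2,1),(2,2),(2,5),(3,1),(3,3),(3,4),(4,0),(4,5),(5,0),(5,2),(5,4),(5,5)}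


namespace TC

/-! ### Computation on codes

Elements of the field with 8 elements are coded by numbers below 8, words of length 49 by
numbers with 49 octal digits. -/

/-- mask of the top bits of the digits -/
def ms4 : ℕ := 101946263764711420075591854960678224027339044

/-- mask of the two low bits of the digits -/
def ms3 : ℕ := 76459697823533565056693891220508668020504283

/-- multiplication of every digit by the generator -/
def xt (w : ℕ) : ℕ :=
  Nat.xor (Nat.shiftLeft (Nat.land w ms3) 1)
    (Nat.xor (Nat.shiftRight (Nat.land w ms4) 2) (Nat.shiftRight (Nat.land w ms4) 1))

/-- multiplication of every digit of `w` by the scalar `s` -/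
def smul (s w : ℕ) : ℕ :=
  Nat.xor (Nat.mul (Nat.mod s 2) w) (Nat.xor (Nat.mul (Nat.mod (Nat.div s 2) 2) (xt w))
    (Nat.mul (Nat.mod (Nat.div s 4) 2) (xt (xt w))))

/-- digit `p` of a word -/
def dig (w p : ℕ) : ℕ := Nat.land (Nat.shiftRight w (Nat.mul 3 p)) 7

/-- codes of the powers of the generator: 1 2 4 3 6 7 5 -/
def pw (n : ℕ) : ℕ := dig 1566481 (Nat.mod n 7)

/-- inverses -/
def ivc (a : ℕ) : ℕ := dig 9272648 a

/-- pack digits -/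
def mkw (f : ℕ → ℕ) : List ℕ → ℕ
  | [] => 0
  | p :: l => Nat.add (f p) (Nat.mul (mkw f l) 8)

def l7 : List ℕ := [0,1,2,3,4,5,6]
def l8 : List ℕ := [0,1,2,3,4,5,6,7]
def l49 : List ℕ := [0,1,2,3,4,5,6,7,8,9,10,11,12,13,14,15,16,17,18,19,20,21,22,23,24,25,26,27,28,
  29,30,31,32,33,34,35,36,37,38,39,40,41,42,43,44,45,46,47,48]

/-- the evaluation word of the exponent pair `(a, b)` -/
def EW (a b : ℕ) : ℕ := mkw (fun p => pw (a * (p / 7) + b * (p % 7))) l49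

/-- interpolation exponents of row `b`: the start of an arithmetic progression mod 7 -/
def st (b : ℕ) : ℕ := dig 12621 b

/-- the step of that progression -/
def gp (b : ℕ) : ℕ := dig 41099 b

/-- Lagrange coefficient of row `b` at column `x`, for the node `k` among `k, l, m` -/
def lam (b k l m x : ℕ) : ℕ :=
  smul (pw (st b * (x + 7 - k)))
    (smul (smul (Nat.xor (pw (gp b * x)) (pw (gp b * l))) (Nat.xor (pw (gp b * x)) (pw (gp b * m))))
      (ivc (smul (Nat.xor (pw (gp b * k)) (pw (gp b * l)))
        (Nat.xor (pw (gp b * k)) (pw (gp b * m))))))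

/-- interpolation words -/
def WW (b k l m : ℕ) : ℕ := mkw (fun p => smul (lam b k l m (p / 7)) (pw (b * (p % 7)))) l49

/-- free words -/
def TW (a b i j : ℕ) : ℕ :=
  Nat.xor (EW a b) (Nat.xor (WW b 0 i j)
    (Nat.xor (smul (pw (a * i)) (WW b i 0 j)) (smul (pw (a * j)) (WW b j 0 i))))

/-- interpolation on the three points of `P` by `1, Z, Z ^ 2` with `Z = ω ^ (4 y)` -/
def cC (P : ℕ × ℕ × ℕ) (b : ℕ) : ℕ :=
  let z0 := pw (4 * P.1)
  let z1 := pw (4 * P.2.1)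
  let z2 := pw (4 * P.2.2)
  let g0 := pw ((7 - b) * P.1)
  let g1 := pw ((7 - b) * P.2.1)
  let g2 := pw ((7 - b) * P.2.2)
  smul (Nat.xor (smul (Nat.xor g0 g1) (ivc (Nat.xor z0 z1)))
    (smul (Nat.xor g1 g2) (ivc (Nat.xor z1 z2)))) (ivc (Nat.xor z0 z2))

def cB (P : ℕ × ℕ × ℕ) (b : ℕ) : ℕ :=
  let z0 := pw (4 * P.1)
  let z1 := pw (4 * P.2.1)
  let g0 := pw ((7 - b) * P.1)
  let g1 := pw ((7 - b) * P.2.1)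
  Nat.xor (smul (Nat.xor g0 g1) (ivc (Nat.xor z0 z1))) (smul (cC P b) (Nat.xor z0 z1))

def cA (P : ℕ × ℕ × ℕ) (b : ℕ) : ℕ :=
  let z0 := pw (4 * P.1)
  Nat.xor (pw ((7 - b) * P.1)) (smul z0 (Nat.xor (cB P b) (smul z0 (cC P b))))

/-- interpolation on the two points `p, q` by `Z, Z ^ 2` -/
def dC (p q b : ℕ) : ℕ :=
  smul (Nat.xor (pw ((10 - b) * p)) (pw ((10 - b) * q))) (ivc (Nat.xor (pw (4 * p)) (pw (4 * q))))

def dB (p q b : ℕ) : ℕ := Nat.xor (pw ((10 - b) * p)) (smul (pw (4 * p)) (dC p q b))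

/-- the word spanned by the column data `h` at the node `k` -/
def colw (h : ℕ → ℕ) (k l m : ℕ) : ℕ :=
  Nat.xor (smul (h 0) (WW 0 k l m)) (Nat.xor (smul (h 1) (WW 1 k l m))
    (Nat.xor (smul (h 2) (WW 2 k l m)) (Nat.xor (smul (h 4) (WW 4 k l m))
      (smul (h 5) (WW 5 k l m)))))

/-- the three-element subsets, in five groups -/
def trips : List (List (ℕ × ℕ × ℕ)) := [
  [(0,1,2), (0,1,3), (0,1,4), (0,1,5), (0,1,6), (0,2,3), (0,2,4)],
  [(0,2,5), (0,2,6), (0,3,4), (0,3,5), (0,3,6), (0,4,5), (0,4,6)],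
  [(0,5,6), (1,2,3), (1,2,4), (1,2,5), (1,2,6), (1,3,4), (1,3,5)],
  [(1,3,6), (1,4,5), (1,4,6), (1,5,6), (2,3,4), (2,3,5), (2,3,6)],
  [(2,4,5), (2,4,6), (2,5,6), (3,4,5), (3,4,6), (3,5,6), (4,5,6)]]

/-- the two-element subsets -/
def duos : List (ℕ × ℕ) := [
  (0,1), (0,2), (0,3), (0,4), (0,5), (0,6), (1,2),
  (1,3), (1,4), (1,5), (1,6), (2,3), (2,4), (2,5),
  (2,6), (3,4), (3,5), (3,6), (4,5), (4,6), (5,6)]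

/-! ### Strict evaluation -/

def force {β : Type} (n : ℕ) (k : ℕ → β) : β :=
  match n with
  | 0 => k 0
  | Nat.succ m => k (Nat.succ m)

def mapF {α β : Type} (f : α → ℕ) : List α → (List ℕ → β) → β
  | [], k => k []
  | a :: l, k => force (f a) fun v => mapF f l fun r => k (v :: r)

def sel : List ℕ → ℕ → ℕ := fun l n => l.getD n 0

/-- concatenation of blocks of `w` bits -/
def cat {α : Type} (w : ℕ) (f : α → ℕ) : List α → ℕ
  | [] => 0
  | a :: l => Nat.add (f a) (Nat.shiftLeft (cat w f l) w)

/-- extend a table by all multiples of the digit `m` -/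
def ext {β : Type} (m w : ℕ) (tb : List ℕ) (k : List ℕ → β) : β :=
  mapF (fun t => smul t m) l8 fun ms =>
    mapF (fun K => cat w (fun c => sel tb (Nat.xor K c)) ms) l8 k

def exts {β : Type} (p : ℕ) : List ℕ → ℕ → List ℕ → (List ℕ → β) → β
  | [], _, tb, k => k tb
  | W :: l, w, tb, k => ext (dig W p) w tb fun tb' => exts p l (Nat.mul w 8) tb' k

def tb0 : List ℕ := [1,0,0,0,0,0,0,0]

/-- tables of all extensions by a digit -/
def tabs8 {β : Type} (w : ℕ) (tb : List ℕ) : List ℕ → (List (List ℕ) → β) → β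
  | [], k => k []
  | m :: l, k => ext m w tb fun t => tabs8 w tb l fun r => k (t :: r)

/-- table of position `p` for the inner words `s A + B + (combination of Ts)` -/
def tabP {β : Type} (Ts : List ℕ) (AB : List (List (ℕ × ℕ))) (p : ℕ) (k : List ℕ → β) : β :=
  exts p Ts 6 tb0 fun tb => tabs8 3072 tb l8 fun tt =>
    mapF (fun K => cat 172032 (cat 24576 (fun ab : ℕ × ℕ =>
      sel (tt.getD (dig ab.1 p) []) (Nat.xor K (dig ab.2 p)))) AB) l8 k

/-- table of position `p` for the inner words `B + (combination of Ts)` -/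
def tabR {β : Type} (Ts : List ℕ) (Bs : List ℕ) (p : ℕ) (k : List ℕ → β) : β :=
  exts p Ts 6 tb0 fun tb =>
    mapF (fun K => cat 3072 (fun B => sel tb (Nat.xor K (dig B p))) Bs) l8 k

/-- all positions -/
def tabsF {β : Type} (f : ℕ → (List ℕ → β) → β) : List ℕ → (List (List ℕ) → β) → β
  | [], k => k []
  | p :: l, k => f p fun t => tabsF f l fun r => k (t :: r)

/-- agreement counters of the outer word `o` with all inner words -/
def agr (ini : ℕ) : List (List ℕ) → ℕ → ℕ
  | [], _ => ini
  | t :: T, o => force (Nat.shiftRight o 3) fun o' => Nat.add (sel t (Nat.land o 7)) (agr ini T o')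

def allF {α : Type} (f : α → Bool) : List α → Bool
  | [] => true
  | a :: l => Bool.rec false (allF f l) (f a)

def ones (n : ℕ) : ℕ := Nat.div (Nat.sub (Nat.shiftLeft 1 (Nat.mul 6 n)) 1) 63

/-- strict map into pairs -/
def pairF {α β : Type} (f g : α → ℕ) : List α → (List (ℕ × ℕ) → β) → β
  | [], k => k []
  | a :: l, k => force (f a) fun v => force (g a) fun v' => pairF f g l fun r => k ((v, v') :: r)

/-- strict map into lists of pairs -/
def pairsF {α β : Type} (f g : α → ℕ) : List (List α) → (List (List (ℕ × ℕ)) → β) → β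
  | [], k => k []
  | a :: l, k => pairF f g a fun v => pairsF f g l fun r => k (v :: r)

def AWo (k l m : ℕ) (P : ℕ × ℕ × ℕ) : ℕ := colw (cA P) k l m
def BWo (c k l m : ℕ) (P : ℕ × ℕ × ℕ) : ℕ := smul (smul c (pw (3 * k))) (colw (cB P) k l m)
def DWo (k l m : ℕ) (P : ℕ × ℕ) : ℕ := smul (pw (3 * k)) (colw (dB P.1 P.2) k l m)

def frees : List (ℕ × ℕ) := [(0,0),(4,5),(5,5)]

/-- strict list of the free words -/
def freeF {β : Type} (i j : ℕ) (k : List ℕ → β) : β :=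
  mapF (fun ab : ℕ × ℕ => TW ab.1 ab.2 i j) frees k

/-- initial counters and the mask, for `n` inner words -/
def inim {β : Type} (n : ℕ) (k : ℕ → ℕ → β) : β :=
  force (ones n) fun one => force (Nat.mul 3 one) fun ini => force (Nat.mul 32 one) fun msk =>
    k ini msk

/-- the main check: no combination of an outer and an inner word has 29 or more zeros -/
def chk (c i j base : ℕ) (ss : List ℕ) : Bool :=
  pairsF (AWo j 0 i) (BWo c j 0 i) trips fun AB =>
  freeF i j fun Ts =>
  tabsF (tabP Ts AB) l49 fun T =>
  inim 143360 fun ini msk =>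
  pairsF (AWo i 0 j) (BWo c i 0 j) trips fun CD =>
  force base fun base =>
  allF (allF (fun cd : ℕ × ℕ => allF (fun s =>
    Nat.beq (Nat.land (agr ini T (Nat.xor base (Nat.xor (smul s cd.1) cd.2))) msk) 0) ss)) CD

def base1 (i j d : ℕ) : ℕ := Nat.xor (EW 3 3) (colw (dB 0 d) 0 i j)

/-- three columns of weights 2, 3, 2 -/
def chkB (i j : ℕ) : Bool :=
  mapF (DWo j 0 i) duos fun Bs =>
  freeF i j fun Ts =>
  tabsF (tabR Ts Bs) l49 fun T =>
  inim 10752 fun ini msk =>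
  pairsF (AWo i 0 j) (BWo 1 i 0 j) trips fun CD =>
  mapF (base1 i j) [1,2,3] fun bs =>
  allF (fun base => allF (allF (fun cd : ℕ × ℕ => allF (fun s =>
    Nat.beq (Nat.land (agr ini T (Nat.xor base (Nat.xor (smul s cd.1) cd.2))) msk) 0) l8)) CD) bs

/-- three columns of weight 2 -/
def chkC (i j : ℕ) : Bool :=
  mapF (DWo j 0 i) duos fun Bs =>
  freeF i j fun Ts =>
  tabsF (tabR Ts Bs) l49 fun T =>
  inim 10752 fun ini msk =>
  mapF (DWo i 0 j) duos fun Cs =>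
  mapF (base1 i j) [1,2,3] fun bs =>
  allF (fun base => allF (fun C =>
    Nat.beq (Nat.land (agr ini T (Nat.xor base C)) msk) 0) Cs) bs

/-- the check for words vanishing on columns `0` and `j` -/
def chk2 (i j : ℕ) : Bool :=
  freeF i j fun Ts =>
  mapF (fun b => WW b i 0 j) [0,5] fun w05 =>
  tabsF (fun p => exts p (w05 ++ Ts) 6 tb0) l49 fun T =>
  inim 32768 fun ini msk =>
  mapF (fun b => WW b i 0 j) [1,2,4] fun w =>
  allF (fun s1 => allF (fun s2 => allF (fun s4 =>
    Nat.beq (Nat.land (agr ini T (Nat.xor (smul s1 (sel w 0)) (Nat.xor (smul s2 (sel w 1))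
      (smul s4 (sel w 2))))) msk)
      (Nat.mul 32 (Nat.sub 1 (Nat.add s1 (Nat.add s2 s4))))) l8) l8) l8

end TC

namespace TC

/-! ### The field -/

/-- the field element coded by the three lowest bits of `n` -/
noncomputable def phi (a : F8) (n : ℕ) : F8 :=
  (if n.testBit 0 then 1 else 0) + (if n.testBit 1 then a else 0) + (if n.testBit 2 then a ^ 2 else 0)

/-- the value of a word at position `p` -/
noncomputable def val (a : F8) (w p : ℕ) : F8 :=
  (if w.testBit (3 * p) then 1 else 0) + (if w.testBit (3 * p + 1) then a else 0) +
    (if w.testBit (3 * p + 2) then a ^ 2 else 0)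

theorem two0 (x : F8) : x + x = 0 := CharTwo.add_self_eq_zero x

theorem val_zero (a : F8) (n : ℕ) : val a n 0 = phi a n := by
  simp [val, phi]

theorem testBit_dig (w p i : ℕ) : (dig w p).testBit i = (decide (i < 3) && w.testBit (3 * p + i)) := by
  have : dig w p = (w >>> (3 * p)) &&& (2 ^ 3 - 1) := rfl
  rw [this, Nat.testBit_and, Nat.testBit_two_pow_sub_one, Nat.testBit_shiftRight, Bool.and_comm]

theorem phi_dig (a : F8) (w p : ℕ) : phi a (dig w p) = val a w p := by
  simp only [phi, val, testBit_dig]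
  rfl

theorem dig_lt (w p : ℕ) : dig w p < 8 := by
  have : dig w p = (w >>> (3 * p)) &&& 7 := rfl
  rw [this]
  exact lt_of_le_of_lt Nat.and_le_right (by norm_num)

theorem val_xor (a : F8) (v w p : ℕ) : val a (Nat.xor v w) p = val a v p + val a w p := by
  have h : Nat.xor v w = v ^^^ w := rfl
  have h1 := two0 (1 : F8)
  have h2 := two0 a
  have h3 := two0 (a ^ 2)
  rw [h]
  simp only [val, Nat.testBit_xor]
  cases v.testBit (3 * p) <;> cases w.testBit (3 * p) <;> cases v.testBit (3 * p + 1) <;>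
    cases w.testBit (3 * p + 1) <;> cases v.testBit (3 * p + 2) <;> cases w.testBit (3 * p + 2) <;>
    simp <;> grind

theorem phi_xor (a : F8) (v w : ℕ) : phi a (Nat.xor v w) = phi a v + phi a w := by
  simp only [← val_zero, val_xor]

theorem val_0 (a : F8) (p : ℕ) : val a 0 p = 0 := by simp [val]

theorem ms_bits : ∀ p < 50, (ms4.testBit (3 * p) = false ∧ ms4.testBit (3 * p + 1) = false ∧
    ms3.testBit (3 * p + 2) = false) ∧ (p < 49 → ms4.testBit (3 * p + 2) = true ∧
    ms3.testBit (3 * p) = true ∧ ms3.testBit (3 * p + 1) = true) := by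
  decide +kernel

theorem testBit_xt (w n : ℕ) : (xt w).testBit n =
    ((decide (1 ≤ n) && (w.testBit (n - 1) && ms3.testBit (n - 1))) ^^
      ((w.testBit (2 + n) && ms4.testBit (2 + n)) ^^ (w.testBit (1 + n) && ms4.testBit (1 + n)))) := by
  have h : xt w = ((w &&& ms3) <<< 1) ^^^ (((w &&& ms4) >>> 2) ^^^ ((w &&& ms4) >>> 1)) := rfl
  rw [h]
  simp only [Nat.testBit_xor, Nat.testBit_shiftLeft, Nat.testBit_shiftRight, Nat.testBit_and, ge_iff_le]

theorem val_xt {a : F8} (ha : a ^ 3 = a + 1) (w p : ℕ) (hp : p < 49) :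
    val a (xt w) p = a * val a w p := by
  obtain ⟨⟨h1, h2, h3⟩, h4⟩ := ms_bits p (by omega)
  obtain ⟨h4, h5, h6⟩ := h4 hp
  obtain ⟨⟨k1, k2, k3⟩, -⟩ := ms_bits (p + 1) (by omega)
  have e0 : (xt w).testBit (3 * p) = w.testBit (3 * p + 2) := by
    rw [testBit_xt, show 2 + 3 * p = 3 * p + 2 by ring, show 1 + 3 * p = 3 * p + 1 by ring, h4, h2]
    rcases Nat.eq_zero_or_pos p with rfl | h
    · simp
    · obtain ⟨q, rfl⟩ : ∃ q, p = q + 1 := ⟨p - 1, by omega⟩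
      obtain ⟨⟨-, -, m3⟩, -⟩ := ms_bits q (by omega)
      rw [show 3 * (q + 1) - 1 = 3 * q + 2 by omega, m3]
      simp
  have e1 : (xt w).testBit (3 * p + 1) = (w.testBit (3 * p) ^^ w.testBit (3 * p + 2)) := by
    rw [testBit_xt, show 2 + (3 * p + 1) = 3 * (p + 1) by ring,
      show 1 + (3 * p + 1) = 3 * p + 2 by ring, show 3 * p + 1 - 1 = 3 * p by omega, h4, k1, h5]
    simp
  have e2 : (xt w).testBit (3 * p + 2) = w.testBit (3 * p + 1) := by
    rw [testBit_xt, show 2 + (3 * p + 2) = 3 * (p + 1) + 1 by ring,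
      show 1 + (3 * p + 2) = 3 * (p + 1) by ring, show 3 * p + 2 - 1 = 3 * p + 1 by omega, k1, k2, h6]
    simp
  have t2 := two0 a
  simp only [val, e0, e1, e2]
  cases w.testBit (3 * p) <;> cases w.testBit (3 * p + 1) <;> cases w.testBit (3 * p + 2) <;>
    simp <;> grind

theorem val_bmul (a : F8) (s w p : ℕ) :
    val a (Nat.mul (Nat.mod s 2) w) p = (if s.testBit 0 then 1 else 0) * val a w p := by
  have h : Nat.mul (Nat.mod s 2) w = (s % 2) * w := rfl
  rw [h, Nat.testBit_zero]
  rcases Nat.mod_two_eq_zero_or_one s with h | h <;> simp [h, val_0]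

theorem val_smul {a : F8} (ha : a ^ 3 = a + 1) (s w p : ℕ) (hp : p < 49) :
    val a (smul s w) p = phi a s * val a w p := by
  have h1 : (Nat.div s 2).testBit 0 = s.testBit 1 := by
    rw [show Nat.div s 2 = s / 2 ^ 1 from rfl, Nat.testBit_div_two_pow]
  have h2 : (Nat.div s 4).testBit 0 = s.testBit 2 := by
    rw [show Nat.div s 4 = s / 2 ^ 2 from rfl, Nat.testBit_div_two_pow]
  rw [smul, val_xor, val_xor, val_bmul, val_bmul, val_bmul, val_xt ha _ _ hp, val_xt ha _ _ hp,
    val_xt ha _ _ hp, h1, h2, phi]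
  split_ifs <;> ring

theorem phi_smul {a : F8} (ha : a ^ 3 = a + 1) (s w : ℕ) :
    phi a (smul s w) = phi a s * phi a w := by
  simp only [← val_zero a w, ← val_zero a (smul s w), val_smul ha s w 0 (by norm_num)]

theorem ane {a : F8} (ha : a ^ 3 = a + 1) : a ≠ 0 := by
  rintro rfl
  simp at ha

theorem a1ne {a : F8} (ha : a ^ 3 = a + 1) : a + 1 ≠ 0 := by
  rw [← ha]
  exact pow_ne_zero _ (ane ha)

theorem phi_eq_zero {a : F8} (ha : a ^ 3 = a + 1) {n : ℕ} (hn : n < 8) (h : phi a n = 0) : n = 0 := by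
  have h0 := ane ha
  have h1 := a1ne ha
  have t := two0 a
  have t1 := two0 (1 : F8)
  have m1 := mul_ne_zero h0 h1
  have m2 := mul_ne_zero h1 h1
  have m3 := mul_ne_zero (mul_ne_zero h0 h0) h1
  have m4 := mul_ne_zero h0 h0
  interval_cases n
  · rfl
  all_goals exfalso; simp [phi, Nat.testBit] at h; try grind

theorem phi_inj {a : F8} (ha : a ^ 3 = a + 1) {m n : ℕ} (hm : m < 8) (hn : n < 8)
    (h : phi a m = phi a n) : m = n := by
  have h1 : phi a (Nat.xor m n) = 0 := by rw [phi_xor, h, two0]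
  have h2 := phi_eq_zero ha (show Nat.xor m n < 8 from Nat.xor_lt_two_pow (n := 3) hm hn) h1
  exact Nat.xor_eq_zero_iff.1 h2

theorem phi_surj {a : F8} (ha : a ^ 3 = a + 1) (z : F8) : ∃ n < 8, phi a n = z := by
  have : Fintype F8 := Fintype.ofFinite _
  have hc : Fintype.card F8 = 8 := by
    rw [← Nat.card_eq_fintype_card, GaloisField.card 2 3 (by norm_num)]; norm_num
  have hb : Function.Bijective (fun n : Fin 8 => phi a n) := by
    rw [Fintype.bijective_iff_injective_and_card]
    refine ⟨fun m n h => Fin.ext (phi_inj ha m.2 n.2 h), by simp [hc]⟩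
  obtain ⟨n, hn⟩ := hb.2 z
  exact ⟨n, n.2, hn⟩

theorem a7 {a : F8} (ha : a ^ 3 = a + 1) : a ^ 7 = 1 := by
  have t := two0 a
  have t2 := two0 (a ^ 2)
  linear_combination (a ^ 4 + a ^ 2 + a + 1) * ha + t2 + t

theorem pow_mod7 {a : F8} (ha : a ^ 3 = a + 1) (n : ℕ) : a ^ (n % 7) = a ^ n := by
  conv_rhs => rw [← Nat.div_add_mod n 7, pow_add, pow_mul, a7 ha, one_pow, one_mul]

theorem phi_pw {a : F8} (ha : a ^ 3 = a + 1) (n : ℕ) : phi a (pw n) = a ^ n := by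
  have t := two0 a
  have t1 := two0 (1 : F8)
  have h : pw n = dig 1566481 (n % 7) := rfl
  rw [← pow_mod7 ha, h]
  have := Nat.mod_lt n (show 0 < 7 by norm_num)
  generalize n % 7 = m at *
  have hd : ∀ m < 7, dig 1566481 m = [1,2,4,3,6,7,5].getD m 0 := by decide
  rw [hd m this]
  interval_cases m <;> simp [phi, Nat.testBit] <;> grind

theorem pw_lt (n : ℕ) : pw n < 8 := dig_lt _ _

theorem smul_lt : ∀ s < 8, ∀ d < 8, smul s d < 8 := by decide +kernel

theorem exists_gen : ∃ a : F8, a ^ 3 = a + 1 := by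
  have : Fintype F8 := Fintype.ofFinite _
  have hc : Fintype.card F8 = 8 := by
    rw [← Nat.card_eq_fintype_card, GaloisField.card 2 3 (by norm_num)]; norm_num
  classical
  obtain ⟨x, hx⟩ : ∃ x : F8, x ∉ ({0, 1} : Finset F8) := by
    by_contra! h
    have : (Finset.univ : Finset F8) ⊆ {0, 1} := fun x _ => h x
    have := Finset.card_le_card this
    rw [Finset.card_univ, hc] at this
    have h2 : ({0, 1} : Finset F8).card ≤ 2 := Finset.card_le_two
    omega
  simp only [Finset.mem_insert, Finset.mem_singleton, not_or] at hx
  have h8 : x ^ 8 = x := by rw [← hc]; exact FiniteField.pow_card x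
  have h7 : x ^ 7 = 1 := by
    apply mul_left_cancel₀ hx.1
    linear_combination h8
  have t : (2 : F8) = 0 := by simpa [one_add_one_eq_two] using two0 (1 : F8)
  have hf : (x - 1) * ((x ^ 3 - (x + 1)) * (x ^ 3 - (x ^ 2 + 1))) = 0 := by
    have : (x - 1) * ((x ^ 3 - (x + 1)) * (x ^ 3 - (x ^ 2 + 1))) = x ^ 7 - 1 := by
      ring_nf
      grind
    rw [this, h7, sub_self]
  rcases mul_eq_zero.1 hf with h | h
  · exact absurd (sub_eq_zero.1 h) hx.2
  rcases mul_eq_zero.1 h with h | h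
  · exact ⟨x, sub_eq_zero.1 h⟩
  · refine ⟨x⁻¹, ?_⟩
    have h0 := hx.1
    field_simp
    linear_combination -h - x ^ 2 * t

end TC

namespace TC

/-! ### Words -/

theorem mkw_shift (f : ℕ → ℕ) (hf : ∀ p, f p < 8) : ∀ (k : ℕ) (l : List ℕ) (hk : k < l.length),
    dig (mkw f l) k = f l[k] := by
  intro k
  induction k with
  | zero =>
    intro l hk
    match l, hk with
    | p :: l, _ =>
      have h : dig (mkw f (p :: l)) 0 = (f p + mkw f l * 8) &&& (2 ^ 3 - 1) := rfl
      rw [h, Nat.and_two_pow_sub_one_eq_mod]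
      have := hf p
      simp only [List.getElem_cons_zero]
      omega
  | succ k ih =>
    intro l hk
    match l, hk with
    | p :: l, hk =>
      have h : dig (mkw f (p :: l)) (k + 1) = ((f p + mkw f l * 8) >>> (3 * (k + 1))) &&& 7 := rfl
      have h' : dig (mkw f l) k = (mkw f l >>> (3 * k)) &&& 7 := rfl
      have h2 : (f p + mkw f l * 8) >>> (3 * (k + 1)) = mkw f l >>> (3 * k) := by
        rw [show 3 * (k + 1) = 3 + 3 * k by ring, Nat.shiftRight_add]
        congr 1
        rw [Nat.shiftRight_eq_div_pow]
        have := hf p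
        omega
      rw [h, h2, ← h', ih l (by simpa using hk)]
      simp

theorem l49_eq : l49 = List.range' 0 49 := by decide
theorem l8_eq : l8 = List.range' 0 8 := by decide

theorem mem_l8 {t : ℕ} : t ∈ l8 ↔ t < 8 := by
  rw [l8_eq]; simp

theorem dig_mkw (f : ℕ → ℕ) (hf : ∀ p, f p < 8) (p : ℕ) (hp : p < 49) :
    dig (mkw f l49) p = f p := by
  rw [mkw_shift f hf p l49 (by simpa [l49_eq] using hp)]
  simp [l49_eq]

theorem val_EW {a : F8} (ha : a ^ 3 = a + 1) (e b p : ℕ) (hp : p < 49) :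
    val a (EW e b) p = a ^ (e * (p / 7) + b * (p % 7)) := by
  rw [← phi_dig, EW, dig_mkw _ (fun _ => pw_lt _) p hp, phi_pw ha]

theorem dig_xor (v w p : ℕ) : dig (Nat.xor v w) p = Nat.xor (dig v p) (dig w p) := by
  have h : Nat.xor (dig v p) (dig w p) = dig v p ^^^ dig w p := rfl
  have h' : Nat.xor v w = v ^^^ w := rfl
  rw [h, h']
  apply Nat.eq_of_testBit_eq
  intro i
  simp only [Nat.testBit_xor, testBit_dig]
  cases decide (i < 3) <;> simp

theorem dig_smul (s w p : ℕ) (hs : s < 8) (hp : p < 49) : dig (smul s w) p = smul s (dig w p) := by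
  obtain ⟨a, ha⟩ := exists_gen
  apply phi_inj ha (dig_lt _ _) (smul_lt s hs _ (dig_lt _ _))
  rw [phi_dig, val_smul ha _ _ _ hp, phi_smul ha, phi_dig]

theorem dig_0 (p : ℕ) : dig 0 p = 0 := by
  have h : dig 0 p = (0 >>> (3 * p)) &&& 7 := rfl
  rw [h, Nat.zero_shiftRight, Nat.zero_and]

theorem xor_lt {m n : ℕ} (hm : m < 8) (hn : n < 8) : Nat.xor m n < 8 :=
  Nat.xor_lt_two_pow (n := 3) hm hn

theorem xor_eq_iff (x y z : ℕ) : x = Nat.xor y z ↔ Nat.xor x z = y := by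
  change x = y ^^^ z ↔ x ^^^ z = y
  constructor
  · rintro rfl
    rw [Nat.xor_assoc, Nat.xor_self, Nat.xor_zero]
  · rintro rfl
    rw [Nat.xor_assoc, Nat.xor_self, Nat.xor_zero]

/-! ### Strict evaluation is evaluation -/

theorem force_eq {β : Type} (n : ℕ) (k : ℕ → β) : force n k = k n := by
  cases n <;> rfl

theorem mapF_eq {α β : Type} (f : α → ℕ) (l : List α) (k : List ℕ → β) :
    mapF f l k = k (l.map f) := by
  induction l generalizing k with
  | nil => rfl
  | cons a l ih => simp only [mapF, force_eq, ih, List.map_cons]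

theorem pairF_eq {α β : Type} (f g : α → ℕ) (l : List α) (k : List (ℕ × ℕ) → β) :
    pairF f g l k = k (l.map fun x => (f x, g x)) := by
  induction l generalizing k with
  | nil => rfl
  | cons a l ih => simp only [pairF, force_eq, ih, List.map_cons]

theorem pairsF_eq {α β : Type} (f g : α → ℕ) (l : List (List α)) (k : List (List (ℕ × ℕ)) → β) :
    pairsF f g l k = k (l.map fun r => r.map fun x => (f x, g x)) := by
  induction l generalizing k with
  | nil => rfl
  | cons a l ih => simp only [pairsF, pairF_eq, ih, List.map_cons]

def extV (m w : ℕ) (tb : List ℕ) : List ℕ :=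
  l8.map fun K => cat w (fun c => sel tb (Nat.xor K c)) (l8.map fun t => smul t m)

theorem ext_eq {β : Type} (m w : ℕ) (tb : List ℕ) (k : List ℕ → β) :
    ext m w tb k = k (extV m w tb) := by
  simp only [ext, mapF_eq, extV]

def extsV (p : ℕ) : List ℕ → ℕ → List ℕ → List ℕ
  | [], _, tb => tb
  | W :: l, w, tb => extsV p l (Nat.mul w 8) (extV (dig W p) w tb)

theorem exts_eq {β : Type} (p : ℕ) (l : List ℕ) (w : ℕ) (tb : List ℕ) (k : List ℕ → β) :
    exts p l w tb k = k (extsV p l w tb) := by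
  induction l generalizing w tb with
  | nil => rfl
  | cons W l ih => simp only [exts, ext_eq, ih, extsV]

theorem tabs8_eq {β : Type} (w : ℕ) (tb l : List ℕ) (k : List (List ℕ) → β) :
    tabs8 w tb l k = k (l.map fun m => extV m w tb) := by
  induction l generalizing k with
  | nil => rfl
  | cons W l ih => simp only [tabs8, ext_eq, ih, List.map_cons]

def tabPV (Ts : List ℕ) (AB : List (List (ℕ × ℕ))) (p : ℕ) : List ℕ :=
  l8.map fun K => cat 172032 (cat 24576 (fun ab : ℕ × ℕ =>
    sel ((l8.map fun m => extV m 3072 (extsV p Ts 6 tb0)).getD (dig ab.1 p) [])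
      (Nat.xor K (dig ab.2 p)))) AB

theorem tabP_eq {β : Type} (Ts : List ℕ) (AB : List (List (ℕ × ℕ))) (p : ℕ) (k : List ℕ → β) :
    tabP Ts AB p k = k (tabPV Ts AB p) := by
  simp only [tabP, exts_eq, tabs8_eq, mapF_eq, tabPV]

def tabRV (Ts : List ℕ) (Bs : List ℕ) (p : ℕ) : List ℕ :=
  l8.map fun K => cat 3072 (fun B => sel (extsV p Ts 6 tb0) (Nat.xor K (dig B p))) Bs

theorem tabR_eq {β : Type} (Ts : List ℕ) (Bs : List ℕ) (p : ℕ) (k : List ℕ → β) :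
    tabR Ts Bs p k = k (tabRV Ts Bs p) := by
  simp only [tabR, exts_eq, mapF_eq, tabRV]

theorem tabsF_eq {β : Type} (f : ℕ → (List ℕ → β) → β) (g : ℕ → List ℕ)
    (h : ∀ p k, f p k = k (g p)) (l : List ℕ) (k : List (List ℕ) → β) :
    tabsF f l k = k (l.map g) := by
  induction l generalizing k with
  | nil => rfl
  | cons W l ih => simp only [tabsF, h, ih, List.map_cons]

theorem inim_eq {β : Type} (n : ℕ) (k : ℕ → ℕ → β) :
    inim n k = k (3 * ones n) (32 * ones n) := by
  simp only [inim, force_eq]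
  rfl

theorem freeF_eq {β : Type} (i j : ℕ) (k : List ℕ → β) :
    freeF i j k = k [TW 0 0 i j, TW 4 5 i j, TW 5 5 i j] := by
  simp only [freeF, mapF_eq, frees, List.map_cons, List.map_nil]

theorem allF_eq {α : Type} (f : α → Bool) (l : List α) : allF f l = true ↔ ∀ x ∈ l, f x = true := by
  induction l with
  | nil => simp [allF]
  | cons x l ih =>
    simp only [allF, List.mem_cons, forall_eq_or_imp, ← ih]
    cases f x <;> simp

/-! ### Tables -/

/-- packed indicator of the words in `L` with digit `K` at `p` -/
def eqd (L : List ℕ) (p K : ℕ) : ℕ := Nat.ofDigits 64 (L.map fun v => if dig v p = K then 1 else 0)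

def Inv (p : ℕ) (L tb : List ℕ) : Prop := ∀ K < 8, sel tb K = eqd L p K

theorem sel_map (f : ℕ → ℕ) (K : ℕ) (hK : K < 8) : sel (l8.map f) K = f K := by
  interval_cases K <;> rfl

theorem cat_eq {α : Type} (n : ℕ) (f : α → ℕ) (D : α → List ℕ) (l : List α)
    (h : ∀ x ∈ l, f x = Nat.ofDigits 64 (D x) ∧ (D x).length = n) :
    cat (6 * n) f l = Nat.ofDigits 64 (l.flatMap D) := by
  induction l with
  | nil => rfl
  | cons x l ih =>
    obtain ⟨h1, h2⟩ := h x (by simp)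
    have e : cat (6 * n) f (x :: l) = f x + (cat (6 * n) f l) <<< (6 * n) := rfl
    rw [e, ih fun y hy => h y (by simp [hy]), h1, List.flatMap_cons, Nat.ofDigits_append, h2,
      Nat.shiftLeft_eq, pow_mul]
    ring

/-- the ext step on lists of words -/
def extL (W : ℕ) (L : List ℕ) : List ℕ := l8.flatMap fun t => L.map fun v => Nat.xor v (smul t W)

theorem extV_spec (p m n : ℕ) (L tb : List ℕ) (hL : L.length = n) (hm : m < 8) (h : Inv p L tb)
    (K : ℕ) (hK : K < 8) : sel (extV m (6 * n) tb) K = Nat.ofDigits 64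
      (l8.flatMap fun t => L.map fun v => if Nat.xor (dig v p) (smul t m) = K then 1 else 0) := by
  rw [extV, sel_map _ _ hK]
  rw [cat_eq n _ (fun c => L.map fun v => if Nat.xor (dig v p) c = K then 1 else 0)]
  · rw [List.flatMap_map]
  · intro c hc
    obtain ⟨t, ht, rfl⟩ := List.mem_map.1 hc
    have hlt := smul_lt t (mem_l8.1 ht) m hm
    refine ⟨?_, by simpa using hL⟩
    rw [h _ (xor_lt hK hlt), eqd]
    simp only [xor_eq_iff]

theorem ext_Inv (p W n : ℕ) (hp : p < 49) (L tb : List ℕ) (hL : L.length = n) (h : Inv p L tb) :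
    Inv p (extL W L) (extV (dig W p) (6 * n) tb) := by
  intro K hK
  rw [extV_spec p _ n L tb hL (dig_lt _ _) h K hK, eqd, extL, List.map_flatMap]
  congr 1
  rw [List.flatMap_congr]
  intro t ht
  rw [List.map_map]
  apply List.map_congr_left
  intro v _
  simp only [Function.comp_apply, dig_xor, dig_smul t W p (mem_l8.1 ht) hp]

theorem length_extL (W : ℕ) (L : List ℕ) : (extL W L).length = 8 * L.length := by
  simp [extL, l8]
  ring

def combL : List ℕ → List ℕ → List ℕ
  | [], L => L
  | W :: l, L => combL l (extL W L)

theorem length_combL (l L : List ℕ) : (combL l L).length = 8 ^ l.length * L.length := by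
  induction l generalizing L with
  | nil => simp [combL]
  | cons W l ih => rw [combL, ih, length_extL, List.length_cons]; ring

theorem exts_Inv (p : ℕ) (hp : p < 49) (l : List ℕ) (n : ℕ) (L tb : List ℕ) (hL : L.length = n)
    (h : Inv p L tb) : Inv p (combL l L) (extsV p l (6 * n) tb) := by
  induction l generalizing n L tb with
  | nil => exact h
  | cons W l ih =>
    rw [combL, extsV, show Nat.mul (6 * n) 8 = 6 * (8 * n) from by change 6 * n * 8 = _; ring]
    exact ih _ _ _ (by rw [length_extL, hL]) (ext_Inv p W n hp L tb hL h)

theorem tb0_Inv (p : ℕ) : Inv p [0] tb0 := by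
  intro K hK
  simp only [eqd, List.map_cons, List.map_nil, dig_0]
  interval_cases K <;> simp [sel, tb0, Nat.ofDigits]

theorem exts0_Inv (p : ℕ) (hp : p < 49) (l : List ℕ) : Inv p (combL l [0]) (extsV p l 6 tb0) :=
  exts_Inv p hp l 1 _ _ rfl (tb0_Inv p)

/-- inner words -/
def inR (Ts Bs : List ℕ) : List ℕ := Bs.flatMap fun B => (combL Ts [0]).map fun v => Nat.xor v B

theorem tabR_Inv (p : ℕ) (hp : p < 49) (Ts Bs : List ℕ) (hT : Ts.length = 3) :
    Inv p (inR Ts Bs) (tabRV Ts Bs p) := by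
  intro K hK
  rw [tabRV, sel_map _ _ hK, show 3072 = 6 * 512 from rfl,
    cat_eq 512 _ (fun B => (combL Ts [0]).map fun v => if dig (Nat.xor v B) p = K then 1 else 0)]
  · rw [eqd, inR, List.map_flatMap]
    simp only [List.map_map, Function.comp_def]
  · intro B _
    refine ⟨?_, by simp [length_combL, hT]⟩
    rw [exts0_Inv p hp Ts _ (xor_lt hK (dig_lt _ _)), eqd]
    simp only [xor_eq_iff, dig_xor]

def inP1 (Ts : List ℕ) (ab : ℕ × ℕ) : List ℕ :=
  l8.flatMap fun t => (combL Ts [0]).map fun v => Nat.xor (Nat.xor v (smul t ab.1)) ab.2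

def inP (Ts : List ℕ) (AB : List (List (ℕ × ℕ))) : List ℕ :=
  AB.flatMap fun g => g.flatMap fun ab => inP1 Ts ab

theorem getD_map (f : ℕ → List ℕ) (K : ℕ) (hK : K < 8) : (l8.map f).getD K [] = f K := by
  interval_cases K <;> rfl

theorem tabP_Inv (p : ℕ) (hp : p < 49) (Ts : List ℕ) (AB : List (List (ℕ × ℕ)))
    (hT : Ts.length = 3) (hAB : ∀ g ∈ AB, g.length = 7) :
    Inv p (inP Ts AB) (tabPV Ts AB p) := by
  intro K hK
  rw [tabPV, sel_map _ _ hK, show 172032 = 6 * 28672 from rfl,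
    cat_eq 28672 _ (fun g => g.flatMap fun ab => (inP1 Ts ab).map fun v => if dig v p = K then 1 else 0)]
  · rw [eqd, inP, List.map_flatMap]
    simp only [List.map_flatMap]
  · intro g hg
    refine ⟨?_, ?_⟩
    · rw [show 24576 = 6 * 4096 from rfl]
      apply cat_eq
      intro ab _
      refine ⟨?_, ?_⟩
      · rw [getD_map _ _ (dig_lt _ _), show 3072 = 6 * 512 from rfl,
          extV_spec p _ 512 (combL Ts [0]) _ (by simp [length_combL, hT]) (dig_lt _ _)
            (exts0_Inv p hp Ts) _ (xor_lt hK (dig_lt _ _)), inP1, List.map_flatMap]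
        congr 1
        rw [List.flatMap_congr]
        intro t ht
        rw [List.map_map]
        apply List.map_congr_left
        intro v _
        simp only [Function.comp_apply, dig_xor, dig_smul t ab.1 p (mem_l8.1 ht) hp, xor_eq_iff]
      · simp [inP1, length_combL, hT, l8]
    · simp [inP1, length_combL, hT, l8, hAB g hg]

theorem length_inP (Ts : List ℕ) (AB : List (List (ℕ × ℕ)))
    (hT : Ts.length = 3) (hAB : ∀ g ∈ AB, g.length = 7) :
    (inP Ts AB).length = AB.length * 28672 := by
  induction AB with
  | nil => rfl
  | cons g AB ih =>
    have := ih fun g hg => hAB g (by simp [hg])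
    simp only [inP, List.flatMap_cons, List.length_append, List.length_cons] at this ⊢
    rw [this]
    have h7 := hAB g (by simp)
    simp [inP1, length_combL, hT, l8, h7]
    ring

theorem length_inR (Ts Bs : List ℕ) (hT : Ts.length = 3) :
    (inR Ts Bs).length = Bs.length * 512 := by
  simp [inR, length_combL, hT]

end TC

namespace TC

/-! ### Agreement counters -/

def agree (o v : ℕ) : ℕ := ∑ p ∈ Finset.range 49, if dig v p = dig o p then 1 else 0

theorem agree_le (o v : ℕ) : agree o v ≤ 49 := by
  have : agree o v ≤ ∑ p ∈ Finset.range 49, 1 :=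
    Finset.sum_le_sum fun p _ => by split_ifs <;> norm_num
  simpa using this

theorem agr_aux (ini o : ℕ) (t : ℕ → List ℕ) (n k : ℕ) :
    agr ini ((List.range' k n).map t) (o >>> (3 * k)) =
      ini + ∑ i ∈ Finset.range n, sel (t (k + i)) (dig o (k + i)) := by
  induction n generalizing k with
  | zero => simp [agr]
  | succ n ih =>
    rw [List.range'_succ, List.map_cons, agr, force_eq]
    have h : Nat.shiftRight (o >>> (3 * k)) 3 = o >>> (3 * (k + 1)) := by
      rw [show 3 * (k + 1) = 3 * k + 3 by ring, Nat.shiftRight_add]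
      rfl
    rw [h, ih (k + 1), Finset.sum_range_succ']
    have h2 : Nat.land (o >>> (3 * k)) 7 = dig o (k + 0) := rfl
    rw [h2]
    change (_ : ℕ) + (_ : ℕ) = _
    rw [show k + 0 = k from rfl]
    have h3 : ∀ i, k + 1 + i = k + (i + 1) := fun i => by ring
    simp only [h3]
    ring

theorem ofDigits_add (L : List ℕ) (f g : ℕ → ℕ) :
    Nat.ofDigits 64 (L.map f) + Nat.ofDigits 64 (L.map g) =
      Nat.ofDigits 64 (L.map fun v => f v + g v) := by
  induction L with
  | nil => rfl
  | cons x L ih => simp only [List.map_cons, Nat.ofDigits_cons, ← ih]; ring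

theorem ofDigits_sum (L : List ℕ) (n : ℕ) (f : ℕ → ℕ → ℕ) :
    ∑ i ∈ Finset.range n, Nat.ofDigits 64 (L.map (f i)) =
      Nat.ofDigits 64 (L.map fun v => ∑ i ∈ Finset.range n, f i v) := by
  induction n with
  | zero =>
    simp only [Finset.range_zero, Finset.sum_empty]
    induction L with
    | nil => rfl
    | cons x L ih => simp only [List.map_cons, Nat.ofDigits_cons, ← ih]; ring
  | succ n ih => simp only [Finset.sum_range_succ, ih, ofDigits_add]

theorem ofDigits_ones (L : List ℕ) (c : ℕ) :
    c * ones L.length = Nat.ofDigits 64 (L.map fun _ => c) := by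
  have key : 63 * Nat.ofDigits 64 (L.map fun _ => 1) + 1 = 64 ^ L.length := by
    induction L with
    | nil => rfl
    | cons x L ih =>
      simp only [List.map_cons, Nat.ofDigits_cons, List.length_cons, pow_succ, ← ih]
      ring
  have h1 : ones L.length = Nat.ofDigits 64 (L.map fun _ => 1) := by
    have : ones L.length = (1 <<< (6 * L.length) - 1) / 63 := rfl
    rw [this, Nat.shiftLeft_eq, pow_mul, show (2 : ℕ) ^ 6 = 64 from rfl, ← key]
    omega
  rw [h1]
  clear key h1
  induction L with
  | nil => rfl
  | cons x L ih =>
    simp only [List.map_cons, Nat.ofDigits_cons, ← ih]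
    ring

theorem land_step (d q r : ℕ) (hd : d < 64) :
    (d + 64 * q) &&& (32 + 64 * r) = (d &&& 32) + 64 * (q &&& r) := by
  have h1 := Nat.and_mod_two_pow (n := 6) (a := d + 64 * q) (b := 32 + 64 * r)
  have h2 := Nat.and_div_two_pow (n := 6) (a := d + 64 * q) (b := 32 + 64 * r)
  rw [show (2 : ℕ) ^ 6 = 64 from rfl] at h1 h2
  rw [show (d + 64 * q) % 64 = d by omega, show (32 + 64 * r) % 64 = 32 by omega] at h1
  rw [show (d + 64 * q) / 64 = q by omega, show (32 + 64 * r) / 64 = r by omega] at h2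
  omega

theorem land_ofDigits (L : List ℕ) (f : ℕ → ℕ) (hf : ∀ v, f v < 64) :
    Nat.ofDigits 64 (L.map f) &&& Nat.ofDigits 64 (L.map fun _ => 32) =
      Nat.ofDigits 64 (L.map fun v => f v &&& 32) := by
  induction L with
  | nil => simp
  | cons x L ih =>
    simp only [List.map_cons, Nat.ofDigits_cons, ← ih]
    exact land_step _ _ _ (hf x)

theorem ofDigits_zero (L : List ℕ) (f : ℕ → ℕ) (h : Nat.ofDigits 64 (L.map f) = 0) :
    ∀ v ∈ L, f v = 0 := by
  induction L with
  | nil => simp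
  | cons x L ih =>
    simp only [List.map_cons, Nat.ofDigits_cons] at h
    intro v hv
    rcases List.mem_cons.1 hv with rfl | hv
    · omega
    · exact ih (by omega) v hv

theorem land32 : ∀ n < 64, n &&& 32 = 0 → n < 32 := by decide

theorem land_agr (L : List ℕ) (t : ℕ → List ℕ) (hT : ∀ p < 49, Inv p L (t p)) (o : ℕ) :
    Nat.land (agr (3 * ones L.length) (l49.map t) o) (32 * ones L.length) =
      Nat.ofDigits 64 (L.map fun v => (3 + agree o v) &&& 32) := by
  have h := agr_aux (3 * ones L.length) o t 49 0
  rw [← l49_eq] at h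
  rw [show o >>> (3 * 0) = o from rfl] at h
  have hs : ∑ i ∈ Finset.range 49, sel (t (0 + i)) (dig o (0 + i)) =
      ∑ i ∈ Finset.range 49, Nat.ofDigits 64 (L.map fun v => if dig v i = dig o i then 1 else 0) := by
    apply Finset.sum_congr rfl
    intro i hi
    rw [zero_add, hT i (Finset.mem_range.1 hi) _ (dig_lt _ _), eqd]
  rw [hs, ofDigits_sum, ofDigits_ones, ofDigits_add] at h
  rw [ofDigits_ones, ofDigits_ones, h]
  apply land_ofDigits
  intro v
  have := agree_le o v
  rw [agree] at this
  omega

theorem ok_spec (L : List ℕ) (t : ℕ → List ℕ) (hT : ∀ p < 49, Inv p L (t p)) (o n : ℕ)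
    (hn : L.length = n)
    (h : Nat.beq (Nat.land (agr (3 * ones n) (l49.map t) o) (32 * ones n)) 0 = true) :
    ∀ v ∈ L, agree o v ≤ 28 := by
  intro v hv
  subst hn
  rw [land_agr L t hT o] at h
  have h1 := ofDigits_zero L _ (Nat.eq_of_beq_eq_true h) v hv
  have := agree_le o v
  have := land32 _ (by omega) h1
  omega

theorem ok_spec2 (L : List ℕ) (t : ℕ → List ℕ) (hT : ∀ p < 49, Inv p (0 :: L) (t p)) (o n : ℕ)
    (hn : (0 :: L).length = n)
    (h : Nat.beq (Nat.land (agr (3 * ones n) (l49.map t) o) (32 * ones n)) 32 = true) :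
    ∀ v ∈ 0 :: L, agree o v ≤ 28 ∨ v = 0 := by
  intro v hv
  subst hn
  rw [land_agr _ t hT o] at h
  have h1 := Nat.eq_of_beq_eq_true h
  rw [List.map_cons, Nat.ofDigits_cons] at h1
  have h2 : (3 + agree o 0) &&& 32 ≤ 32 := Nat.and_le_right
  have h3 : Nat.ofDigits 64 (L.map fun v => (3 + agree o v) &&& 32) = 0 := by omega
  rcases List.mem_cons.1 hv with rfl | hv
  · exact Or.inr rfl
  · have h4 := ofDigits_zero L _ h3 v hv
    have := agree_le o v
    have := land32 _ (by omega) h4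
    exact Or.inl (by omega)

/-! ### What the checks say -/

/-- combination of the free words -/
def fw (i j t0 t1 t2 : ℕ) : ℕ :=
  Nat.xor (Nat.xor (Nat.xor 0 (smul t0 (TW 0 0 i j))) (smul t1 (TW 4 5 i j))) (smul t2 (TW 5 5 i j))

theorem mem_extL {W t v : ℕ} {L : List ℕ} (ht : t < 8) (hv : v ∈ L) : Nat.xor v (smul t W) ∈ extL W L :=
  List.mem_flatMap.2 ⟨t, mem_l8.2 ht, List.mem_map.2 ⟨v, hv, rfl⟩⟩

theorem fw_mem (i j t0 t1 t2 : ℕ) (h0 : t0 < 8) (h1 : t1 < 8) (h2 : t2 < 8) :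
    fw i j t0 t1 t2 ∈ combL [TW 0 0 i j, TW 4 5 i j, TW 5 5 i j] [0] :=
  mem_extL h2 (mem_extL h1 (mem_extL h0 (by simp)))

theorem mem_inP {Ts : List ℕ} {f g : ℕ × ℕ × ℕ → ℕ} {v t : ℕ} {P : ℕ × ℕ × ℕ}
    (hv : v ∈ combL Ts [0]) (ht : t < 8) (hP : P ∈ trips.flatten) :
    Nat.xor (Nat.xor v (smul t (f P))) (g P) ∈ inP Ts (trips.map fun r => r.map fun x => (f x, g x)) := by
  obtain ⟨r, hr, hP⟩ := List.mem_flatten.1 hP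
  refine List.mem_flatMap.2 ⟨_, List.mem_map.2 ⟨r, hr, rfl⟩, ?_⟩
  refine List.mem_flatMap.2 ⟨_, List.mem_map.2 ⟨P, hP, rfl⟩, ?_⟩
  exact List.mem_flatMap.2 ⟨t, mem_l8.2 ht, List.mem_map.2 ⟨v, hv, rfl⟩⟩

theorem mem_inR {Ts Bs : List ℕ} {v B : ℕ} (hv : v ∈ combL Ts [0]) (hB : B ∈ Bs) :
    Nat.xor v B ∈ inR Ts Bs :=
  List.mem_flatMap.2 ⟨B, hB, List.mem_map.2 ⟨v, hv, rfl⟩⟩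

theorem trips7 (f g : ℕ × ℕ × ℕ → ℕ) :
    ∀ r ∈ trips.map fun r => r.map fun x => (f x, g x), r.length = 7 := by
  intro r hr
  obtain ⟨q, hq, rfl⟩ := List.mem_map.1 hr
  rw [List.length_map]
  have key : ∀ q ∈ trips, q.length = 7 := by decide
  exact key q hq

theorem chk_spec {c i j base : ℕ} {ss : List ℕ} (h : chk c i j base ss = true)
    {P Q : ℕ × ℕ × ℕ} (hP : P ∈ trips.flatten) (hQ : Q ∈ trips.flatten) {s t t0 t1 t2 : ℕ}
    (hs : s ∈ ss) (ht : t < 8) (h0 : t0 < 8) (h1 : t1 < 8) (h2 : t2 < 8) :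
    agree (Nat.xor base (Nat.xor (smul s (AWo i 0 j P)) (BWo c i 0 j P)))
      (Nat.xor (Nat.xor (fw i j t0 t1 t2) (smul t (AWo j 0 i Q))) (BWo c j 0 i Q)) ≤ 28 := by
  unfold chk at h
  simp only [pairsF_eq, freeF_eq, force_eq, inim_eq] at h
  rw [tabsF_eq _ _ (fun p k => tabP_eq _ _ p k), allF_eq] at h
  obtain ⟨r, hr, hP⟩ := List.mem_flatten.1 hP
  have h3 := h _ (List.mem_map.2 ⟨r, hr, rfl⟩)
  rw [allF_eq] at h3
  have h4 := h3 _ (List.mem_map.2 ⟨P, hP, rfl⟩)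
  rw [allF_eq] at h4
  have h5 := h4 s hs
  refine ok_spec _ _ (fun p hp => tabP_Inv p hp _ _ rfl (trips7 _ _)) _ 143360 ?_ h5 _
    (mem_inP (fw_mem i j t0 t1 t2 h0 h1 h2) ht hQ)
  rw [length_inP _ _ rfl (trips7 _ _), List.length_map]
  rfl

theorem chkB_spec {i j d : ℕ} (h : chkB i j = true) (hd : d ∈ [1, 2, 3])
    {P : ℕ × ℕ × ℕ} {Q : ℕ × ℕ} (hP : P ∈ trips.flatten) (hQ : Q ∈ duos) {s t0 t1 t2 : ℕ}
    (hs : s < 8) (h0 : t0 < 8) (h1 : t1 < 8) (h2 : t2 < 8) :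
    agree (Nat.xor (base1 i j d) (Nat.xor (smul s (AWo i 0 j P)) (BWo 1 i 0 j P)))
      (Nat.xor (fw i j t0 t1 t2) (DWo j 0 i Q)) ≤ 28 := by
  unfold chkB at h
  simp only [pairsF_eq, freeF_eq, mapF_eq, inim_eq] at h
  rw [tabsF_eq _ _ (fun p k => tabR_eq _ _ p k), allF_eq] at h
  have h := h _ (List.mem_map.2 ⟨d, hd, rfl⟩)
  rw [allF_eq] at h
  obtain ⟨r, hr, hP⟩ := List.mem_flatten.1 hP
  have h3 := h _ (List.mem_map.2 ⟨r, hr, rfl⟩)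
  rw [allF_eq] at h3
  have h4 := h3 _ (List.mem_map.2 ⟨P, hP, rfl⟩)
  rw [allF_eq] at h4
  have h5 := h4 s (mem_l8.2 hs)
  refine ok_spec _ _ (fun p hp => tabR_Inv p hp _ _ rfl) _ 10752 ?_ h5 _
    (mem_inR (fw_mem i j t0 t1 t2 h0 h1 h2) (List.mem_map.2 ⟨Q, hQ, rfl⟩))
  rw [length_inR _ _ rfl, List.length_map]
  rfl

theorem chkC_spec {i j d : ℕ} (h : chkC i j = true) (hd : d ∈ [1, 2, 3])
    {P Q : ℕ × ℕ} (hP : P ∈ duos) (hQ : Q ∈ duos) {t0 t1 t2 : ℕ}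
    (h0 : t0 < 8) (h1 : t1 < 8) (h2 : t2 < 8) :
    agree (Nat.xor (base1 i j d) (DWo i 0 j P))
      (Nat.xor (fw i j t0 t1 t2) (DWo j 0 i Q)) ≤ 28 := by
  unfold chkC at h
  simp only [freeF_eq, mapF_eq, inim_eq] at h
  rw [tabsF_eq _ _ (fun p k => tabR_eq _ _ p k), allF_eq] at h
  have h := h _ (List.mem_map.2 ⟨d, hd, rfl⟩)
  rw [allF_eq] at h
  have h5 := h _ (List.mem_map.2 ⟨P, hP, rfl⟩)
  refine ok_spec _ _ (fun p hp => tabR_Inv p hp _ _ rfl) _ 10752 ?_ h5 _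
    (mem_inR (fw_mem i j t0 t1 t2 h0 h1 h2) (List.mem_map.2 ⟨Q, hQ, rfl⟩))
  rw [length_inR _ _ rfl, List.length_map]
  rfl

/-- inner words of the last check -/
def iw2 (i j s0 s5 t0 t1 t2 : ℕ) : ℕ :=
  Nat.xor (Nat.xor (Nat.xor (Nat.xor (Nat.xor 0 (smul s0 (WW 0 i 0 j))) (smul s5 (WW 5 i 0 j)))
    (smul t0 (TW 0 0 i j))) (smul t1 (TW 4 5 i j))) (smul t2 (TW 5 5 i j))

theorem combL_head (l L : List ℕ) : ∃ M, combL l (0 :: L) = 0 :: M := by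
  induction l generalizing L with
  | nil => exact ⟨L, rfl⟩
  | cons W l ih =>
    have hz : Nat.xor 0 (smul 0 W) = 0 := by
      simp only [smul]
      change 0 ^^^ ((0 * _) ^^^ ((0 * _) ^^^ (0 * _))) = 0
      simp
    have : ∃ M, extL W (0 :: L) = 0 :: M := by
      rw [extL, show l8 = 0 :: [1,2,3,4,5,6,7] from rfl, List.flatMap_cons, List.map_cons, hz]
      exact ⟨_, rfl⟩
    obtain ⟨M, hM⟩ := this
    rw [combL, hM]
    exact ih M

theorem chk2_spec {i j : ℕ} (h : chk2 i j = true) {s0 s1 s2 s4 s5 t0 t1 t2 : ℕ}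
    (k0 : s0 < 8) (k1 : s1 < 8) (k2 : s2 < 8) (k4 : s4 < 8) (k5 : s5 < 8)
    (h0 : t0 < 8) (h1 : t1 < 8) (h2 : t2 < 8) :
    agree (Nat.xor (smul s1 (WW 1 i 0 j)) (Nat.xor (smul s2 (WW 2 i 0 j)) (smul s4 (WW 4 i 0 j))))
      (iw2 i j s0 s5 t0 t1 t2) ≤ 28 ∨ (s1 = 0 ∧ s2 = 0 ∧ s4 = 0 ∧ iw2 i j s0 s5 t0 t1 t2 = 0) := by
  unfold chk2 at h
  simp only [freeF_eq, mapF_eq, inim_eq] at h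
  rw [tabsF_eq _ _ (fun p k => exts_eq p _ _ _ k), allF_eq] at h
  have h := h s1 (mem_l8.2 k1)
  rw [allF_eq] at h
  have h := h s2 (mem_l8.2 k2)
  rw [allF_eq] at h
  have h := h s4 (mem_l8.2 k4)
  simp only [List.map_cons, List.map_nil, List.cons_append, List.nil_append] at h
  rw [show ∀ x y z : ℕ, sel [x, y, z] 0 = x from fun _ _ _ => rfl,
    show ∀ x y z : ℕ, sel [x, y, z] 1 = y from fun _ _ _ => rfl,
    show ∀ x y z : ℕ, sel [x, y, z] 2 = z from fun _ _ _ => rfl] at h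
  have hm : iw2 i j s0 s5 t0 t1 t2 ∈ combL [WW 0 i 0 j, WW 5 i 0 j, TW 0 0 i j, TW 4 5 i j, TW 5 5 i j] [0] :=
    mem_extL h2 (mem_extL h1 (mem_extL h0 (mem_extL k5 (mem_extL k0 (by simp)))))
  have hl : (combL [WW 0 i 0 j, WW 5 i 0 j, TW 0 0 i j, TW 4 5 i j, TW 5 5 i j] [0]).length = 32768 := by
    rw [length_combL]
    simp
  have hI := fun p hp => exts0_Inv p hp [WW 0 i 0 j, WW 5 i 0 j, TW 0 0 i j, TW 4 5 i j, TW 5 5 i j]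
  by_cases hz : s1 = 0 ∧ s2 = 0 ∧ s4 = 0
  · obtain ⟨rfl, rfl, rfl⟩ := hz
    obtain ⟨M, hM⟩ := combL_head [WW 0 i 0 j, WW 5 i 0 j, TW 0 0 i j, TW 4 5 i j, TW 5 5 i j] []
    rw [hM] at hm hl hI
    rw [show Nat.mul 32 (Nat.sub 1 (Nat.add 0 (Nat.add 0 0))) = 32 from rfl] at h
    rcases ok_spec2 M _ hI _ _ hl h _ hm with h | h
    · exact Or.inl h
    · exact Or.inr ⟨rfl, rfl, rfl, h⟩
  · have : Nat.mul 32 (Nat.sub 1 (Nat.add s1 (Nat.add s2 s4))) = 0 := by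
      change 32 * (1 - (s1 + (s2 + s4))) = 0
      omega
    rw [this] at h
    exact Or.inl (ok_spec _ _ hI _ 32768 hl h _ hm)

end TC

namespace TC

/-! ### Codewords -/

/-- the coefficient of `y ^ b`, at the column `x` -/
noncomputable def H (a : F8) (co : ℕ → ℕ → F8) (b x : ℕ) : F8 :=
  match b with
  | 0 => co 0 0 + co 1 0 * a ^ x + co 4 0 * a ^ (4 * x) + co 5 0 * a ^ (5 * x)
  | 1 => co 1 1 * a ^ x + co 2 1 * a ^ (2 * x) + co 3 1 * a ^ (3 * x)
  | 2 => co 0 2 + co 2 2 * a ^ (2 * x) + co 5 2 * a ^ (5 * x)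
  | 3 => co 3 3 * a ^ (3 * x)
  | 4 => co 0 4 + co 3 4 * a ^ (3 * x) + co 5 4 * a ^ (5 * x)
  | 5 => co 0 5 + co 1 5 * a ^ x + co 2 5 * a ^ (2 * x) + co 4 5 * a ^ (4 * x) + co 5 5 * a ^ (5 * x)
  | _ => 0

noncomputable def G (a : F8) (co : ℕ → ℕ → F8) (x y : ℕ) : F8 :=
  H a co 0 x + H a co 1 x * a ^ y + H a co 2 x * a ^ (2 * y) + H a co 3 x * a ^ (3 * y) +
    H a co 4 x * a ^ (4 * y) + H a co 5 x * a ^ (5 * y)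

noncomputable def tr (a : F8) (s : F8) (u v : ℕ) (co : ℕ → ℕ → F8) : ℕ → ℕ → F8 :=
  fun i j => s * co i j * a ^ (i * u + j * v)

theorem G_tr (a s : F8) (u v : ℕ) (co : ℕ → ℕ → F8) (x y : ℕ) :
    G a (tr a s u v co) x y = s * G a co (x + u) (y + v) := by
  simp only [G, H, tr]
  ring

theorem G_per {a : F8} (ha : a ^ 3 = a + 1) (co : ℕ → ℕ → F8) (x y : ℕ) :
    G a co (x + 7) y = G a co x y ∧ G a co x (y + 7) = G a co x y := by
  have h := a7 ha
  have h' : ∀ k, a ^ (k * 7) = 1 := fun k => by rw [mul_comm, pow_mul, h, one_pow]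
  constructor
  all_goals simp only [G, H, mul_add, pow_add, h, h', mul_one]

theorem geo {a : F8} (ha : a ^ 3 = a + 1) (k : ℕ) (hk : k % 7 ≠ 0) :
    1 + a ^ k + a ^ (2 * k) + a ^ (3 * k) + a ^ (4 * k) + a ^ (5 * k) + a ^ (6 * k) = 0 := by
  have h7 : a ^ (7 * k) = 1 := by rw [pow_mul, a7 ha, one_pow]
  have hne : a ^ k - 1 ≠ 0 := by
    intro h
    have h1 : phi a (pw k) = phi a 1 := by
      rw [phi_pw ha, sub_eq_zero.1 h]
      simp [phi, Nat.testBit]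
    have h2 := phi_inj ha (pw_lt k) (by norm_num) h1
    have h3 : ∀ m < 7, dig 1566481 m = 1 → m = 0 := by decide
    exact hk (h3 (k % 7) (Nat.mod_lt _ (by norm_num)) h2)
  have : (a ^ k - 1) * (1 + a ^ k + a ^ (2 * k) + a ^ (3 * k) + a ^ (4 * k) + a ^ (5 * k) +
      a ^ (6 * k)) = 0 := by
    linear_combination h7
  exact (mul_eq_zero.1 this).resolve_left hne

theorem geo7 {a : F8} (ha : a ^ 3 = a + 1) :
    1 + a ^ 7 + a ^ (2 * 7) + a ^ (3 * 7) + a ^ (4 * 7) + a ^ (5 * 7) + a ^ (6 * 7) = 1 := by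
  have h' : ∀ k, a ^ (k * 7) = 1 := fun k => by rw [mul_comm, pow_mul, a7 ha, one_pow]
  simp only [h', a7 ha]
  have := two0 (1 : F8)
  linear_combination 3 * this

theorem dft {a : F8} (ha : a ^ 3 = a + 1) (co : ℕ → ℕ → F8) (x b : ℕ) (hb : b < 7) :
    ∑ y ∈ Finset.range 7, a ^ ((7 - b) * y) * G a co x y = H a co b x := by
  have g7 := geo7 ha
  have g (k : ℕ) (hk : k % 7 ≠ 0) := geo ha k hk
  have h6 : H a co 6 x = 0 := rfl
  simp only [Finset.sum_range_succ, Finset.sum_range_zero, G]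
  interval_cases b
  · linear_combination H a co 0 x * g7 + H a co 1 x * g 8 (by norm_num) + H a co 2 x * g 9 (by norm_num) +
      H a co 3 x * g 10 (by norm_num) + H a co 4 x * g 11 (by norm_num) + H a co 5 x * g 12 (by norm_num)
  · linear_combination H a co 0 x * g 6 (by norm_num) + H a co 1 x * g7 + H a co 2 x * g 8 (by norm_num) +
      H a co 3 x * g 9 (by norm_num) + H a co 4 x * g 10 (by norm_num) + H a co 5 x * g 11 (by norm_num)
  · linear_combination H a co 0 x * g 5 (by norm_num) + H a co 1 x * g 6 (by norm_num) + H a co 2 x * g7 +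
      H a co 3 x * g 8 (by norm_num) + H a co 4 x * g 9 (by norm_num) + H a co 5 x * g 10 (by norm_num)
  · linear_combination H a co 0 x * g 4 (by norm_num) + H a co 1 x * g 5 (by norm_num) + H a co 2 x * g 6 (by norm_num) +
      H a co 3 x * g7 + H a co 4 x * g 8 (by norm_num) + H a co 5 x * g 9 (by norm_num)
  · linear_combination H a co 0 x * g 3 (by norm_num) + H a co 1 x * g 4 (by norm_num) + H a co 2 x * g 5 (by norm_num) +
      H a co 3 x * g 6 (by norm_num) + H a co 4 x * g7 + H a co 5 x * g 8 (by norm_num)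
  · linear_combination H a co 0 x * g 2 (by norm_num) + H a co 1 x * g 3 (by norm_num) + H a co 2 x * g 4 (by norm_num) +
      H a co 3 x * g 5 (by norm_num) + H a co 4 x * g 6 (by norm_num) + H a co 5 x * g7
  · rw [h6]
    linear_combination H a co 0 x * g 1 (by norm_num) + H a co 1 x * g 2 (by norm_num) + H a co 2 x * g 3 (by norm_num) +
      H a co 3 x * g 4 (by norm_num) + H a co 4 x * g 5 (by norm_num) + H a co 5 x * g 6 (by norm_num)

/-! ### Columns of small weight -/

def rows5 : List ℕ := [0, 1, 2, 4, 5]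

theorem trip_id : ∀ P ∈ trips.flatten, ∀ b ∈ rows5, ∀ y ∈ [P.1, P.2.1, P.2.2],
    pw ((7 - b) * y) =
      Nat.xor (cA P b) (Nat.xor (smul (cB P b) (pw (4 * y))) (smul (cC P b) (pw y))) := by
  decide +kernel

theorem duo_id : ∀ P ∈ duos, ∀ b ∈ rows5, ∀ y ∈ [P.1, P.2],
    pw ((7 - b) * y) = Nat.xor (smul (dB P.1 P.2 b) (pw (4 * y))) (smul (dC P.1 P.2 b) (pw y)) := by
  decide +kernel

theorem rows5_lt : ∀ b ∈ rows5, b < 7 := by decide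

theorem trip_col {a : F8} (ha : a ^ 3 = a + 1) (co : ℕ → ℕ → F8) (x : ℕ) {P : ℕ × ℕ × ℕ}
    (hP : P ∈ trips.flatten) (h : ∀ y < 7, y ∉ [P.1, P.2.1, P.2.2] → G a co x y = 0)
    {b : ℕ} (hb : b ∈ rows5) :
    H a co b x = phi a (cA P b) * H a co 0 x + phi a (cB P b) * H a co 3 x := by
  have e0 := dft ha co x 0 (by norm_num)
  have e3 := dft ha co x 3 (by norm_num)
  have e6 := dft ha co x 6 (by norm_num)
  have h6 : H a co 6 x = 0 := rfl
  rw [h6] at e6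
  rw [← dft ha co x b (rows5_lt b hb), ← e0, ← e3]
  have key : ∑ y ∈ Finset.range 7, a ^ ((7 - b) * y) * G a co x y =
      ∑ y ∈ Finset.range 7, (phi a (cA P b) * (a ^ ((7 - 0) * y) * G a co x y) +
        phi a (cB P b) * (a ^ ((7 - 3) * y) * G a co x y) +
        phi a (cC P b) * (a ^ ((7 - 6) * y) * G a co x y)) := by
    apply Finset.sum_congr rfl
    intro y hy
    by_cases hm : y ∈ [P.1, P.2.1, P.2.2]
    · have h1 := congrArg (phi a) (trip_id P hP b hb y hm)
      simp only [phi_xor, phi_smul ha, phi_pw ha] at h1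
      have h7 : a ^ ((7 - 0) * y) = 1 := by
        rw [show (7 - 0) * y = 7 * y from rfl, pow_mul, a7 ha, one_pow]
      rw [h1, h7, show (7 - 3) * y = 4 * y from rfl, show (7 - 6) * y = y by omega]
      ring
    · rw [h y (Finset.mem_range.1 hy) hm]
      ring
  rw [key, Finset.sum_add_distrib, Finset.sum_add_distrib, ← Finset.mul_sum, ← Finset.mul_sum,
    ← Finset.mul_sum, e6]
  ring

theorem duo_col {a : F8} (ha : a ^ 3 = a + 1) (co : ℕ → ℕ → F8) (x : ℕ) {P : ℕ × ℕ}
    (hP : P ∈ duos) (h : ∀ y < 7, y ∉ [P.1, P.2] → G a co x y = 0)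
    {b : ℕ} (hb : b ∈ rows5) :
    H a co b x = phi a (dB P.1 P.2 b) * H a co 3 x := by
  have e3 := dft ha co x 3 (by norm_num)
  have e6 := dft ha co x 6 (by norm_num)
  have h6 : H a co 6 x = 0 := rfl
  rw [h6] at e6
  rw [← dft ha co x b (rows5_lt b hb), ← e3]
  have key : ∑ y ∈ Finset.range 7, a ^ ((7 - b) * y) * G a co x y =
      ∑ y ∈ Finset.range 7, (phi a (dB P.1 P.2 b) * (a ^ ((7 - 3) * y) * G a co x y) +
        phi a (dC P.1 P.2 b) * (a ^ ((7 - 6) * y) * G a co x y)) := by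
    apply Finset.sum_congr rfl
    intro y hy
    by_cases hm : y ∈ [P.1, P.2]
    · have h1 := congrArg (phi a) (duo_id P hP b hb y hm)
      simp only [phi_xor, phi_smul ha, phi_pw ha] at h1
      rw [h1, show (7 - 3) * y = 4 * y from rfl, show (7 - 6) * y = y by omega]
      ring
    · rw [h y (Finset.mem_range.1 hy) hm]
      ring
  rw [key, Finset.sum_add_distrib, ← Finset.mul_sum, ← Finset.mul_sum, e6]
  ring

theorem single_col {a : F8} (ha : a ^ 3 = a + 1) (co : ℕ → ℕ → F8) (x q : ℕ)
    (h : ∀ y < 7, y ≠ q → G a co x y = 0) : H a co 3 x = 0 := by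
  have e6 := dft ha co x 6 (by norm_num)
  have h6 : H a co 6 x = 0 := rfl
  rw [h6] at e6
  have hz : ∀ y ∈ Finset.range 7, G a co x y = 0 := by
    intro y hy
    by_cases hq : y = q
    · subst hq
      rw [Finset.sum_eq_single_of_mem y hy] at e6
      · exact (mul_eq_zero.1 e6).resolve_left (pow_ne_zero _ (ane ha))
      · intro z hz hne
        rw [h z (Finset.mem_range.1 hz) hne, mul_zero]
    · exact h y (Finset.mem_range.1 hy) hq
  rw [← dft ha co x 3 (by norm_num)]
  apply Finset.sum_eq_zero
  intro y hy
  rw [hz y hy, mul_zero]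

/-! ### Interpolation in the columns -/

noncomputable def N (a : F8) (co : ℕ → ℕ → F8) (k l m p : ℕ) : F8 :=
  H a co 0 k * val a (WW 0 k l m) p + H a co 1 k * val a (WW 1 k l m) p +
    H a co 2 k * val a (WW 2 k l m) p + H a co 4 k * val a (WW 4 k l m) p +
    H a co 5 k * val a (WW 5 k l m) p

def ijs : List (ℕ × ℕ) := [(1,2), (1,3), (1,4), (1,5), (2,4), (3,4), (5,6), (2,1)]

def aps : List (ℕ × ℕ) := [(5,0), (1,0), (4,0), (1,1), (2,1), (3,1), (5,2), (0,2), (2,2),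
  (3,4), (5,4), (0,4), (0,5), (1,5), (2,5)]

theorem ap_id : ∀ q ∈ ijs, ∀ e ∈ aps, EW e.1 e.2 = Nat.xor (WW e.2 0 q.1 q.2)
    (Nat.xor (smul (pw (e.1 * q.1)) (WW e.2 q.1 0 q.2))
      (smul (pw (e.1 * q.2)) (WW e.2 q.2 0 q.1))) := by
  decide +kernel

theorem ap_val {a : F8} (ha : a ^ 3 = a + 1) {i j : ℕ} (hij : (i, j) ∈ ijs) (e b : ℕ)
    (he : (e, b) ∈ aps) (p : ℕ) (hp : p < 49) :
    a ^ (e * (p / 7) + b * (p % 7)) = val a (WW b 0 i j) p + (a ^ (e * i) * val a (WW b i 0 j) p +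
      a ^ (e * j) * val a (WW b j 0 i) p) := by
  have h := congrArg (fun w => val a w p) (ap_id (i, j) hij (e, b) he)
  simp only [val_xor, val_smul ha _ _ _ hp, phi_pw ha, val_EW ha _ _ _ hp] at h
  exact h

theorem tw_val {a : F8} (ha : a ^ 3 = a + 1) (i j e b p : ℕ) (hp : p < 49) :
    a ^ (e * (p / 7) + b * (p % 7)) = val a (TW e b i j) p + (val a (WW b 0 i j) p +
      (a ^ (e * i) * val a (WW b i 0 j) p + a ^ (e * j) * val a (WW b j 0 i) p)) := by
  simp only [TW, val_xor, val_smul ha _ _ _ hp, phi_pw ha, val_EW ha _ _ _ hp]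
  have := two0 (val a (WW b 0 i j) p + (a ^ (e * i) * val a (WW b i 0 j) p +
    a ^ (e * j) * val a (WW b j 0 i) p))
  linear_combination -this

theorem decomp {a : F8} (ha : a ^ 3 = a + 1) (co : ℕ → ℕ → F8) {i j : ℕ} (hij : (i, j) ∈ ijs)
    (p : ℕ) (hp : p < 49) :
    G a co (p / 7) (p % 7) = N a co 0 i j p + N a co i 0 j p + N a co j 0 i p +
      (co 0 0 * val a (TW 0 0 i j) p + co 4 5 * val a (TW 4 5 i j) p +
        co 5 5 * val a (TW 5 5 i j) p) + co 3 3 * val a (EW 3 3) p := by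
  have f (e b : ℕ) (he : (e, b) ∈ aps) := ap_val ha hij e b he p hp
  have t (e b : ℕ) := tw_val ha i j e b p hp
  have h33 := val_EW ha 3 3 p hp
  simp only [G, H, N]
  linear_combination
    co 5 0 * f 5 0 (by decide) +
    co 1 0 * f 1 0 (by decide) +
    co 4 0 * f 4 0 (by decide) +
    co 1 1 * f 1 1 (by decide) +
    co 2 1 * f 2 1 (by decide) +
    co 3 1 * f 3 1 (by decide) +
    co 5 2 * f 5 2 (by decide) +
    co 0 2 * f 0 2 (by decide) +
    co 2 2 * f 2 2 (by decide) +
    co 3 4 * f 3 4 (by decide) +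
    co 5 4 * f 5 4 (by decide) +
    co 0 4 * f 0 4 (by decide) +
    co 0 5 * f 0 5 (by decide) +
    co 1 5 * f 1 5 (by decide) +
    co 2 5 * f 2 5 (by decide) +
    co 0 0 * t 0 0 +
    co 4 5 * t 4 5 +
    co 5 5 * t 5 5 - co 3 3 * h33

end TC

namespace TC

/-! ### The computations -/

set_option maxRecDepth 100000 in
set_option maxHeartbeats 0 in
theorem checks :
    (chk 1 1 3 (base1 1 3 1) l8 = true ∧ chk 1 1 3 (base1 1 3 2) l8 = true ∧
      chk 1 1 3 (base1 1 3 3) l8 = true) ∧ chkB 1 2 = true ∧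
    (chkC 1 2 = true ∧ chkC 1 3 = true ∧ chkC 1 4 = true ∧ chkC 1 5 = true ∧ chkC 2 4 = true) ∧
    (chk 0 1 2 0 [1] = true ∧ chk 0 3 4 0 [1] = true ∧ chk 0 5 6 0 [1] = true) ∧
    (chk2 2 1 = true ∧ chk2 1 2 = true ∧ chk2 1 3 = true) := by
  refine ⟨⟨?_, ?_, ?_⟩, ?_, ⟨?_, ?_, ?_, ?_, ?_⟩, ⟨?_, ?_, ?_⟩, ⟨?_, ?_, ?_⟩⟩
  all_goals decide +kernel

end TC

namespace TC

/-! ### Weights -/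

open Classical in
/-- weight of a column -/
noncomputable def wt (a : F8) (co : ℕ → ℕ → F8) (x : ℕ) : ℕ :=
  ∑ y ∈ Finset.range 7, if G a co x y = 0 then 0 else 1

noncomputable def tot (a : F8) (co : ℕ → ℕ → F8) : ℕ := ∑ x ∈ Finset.range 7, wt a co x

theorem per_sum (f : ℕ → ℕ) (hf : ∀ x, f (x + 7) = f x) (u : ℕ) :
    ∑ i ∈ Finset.range 7, f (i + u) = ∑ i ∈ Finset.range 7, f i := by
  induction u with
  | zero => rfl
  | succ u ih =>
    rw [← ih]
    rw [Finset.sum_range_succ' (fun i => f (i + u)) 6, Finset.sum_range_succ]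
    have h1 : f (6 + (u + 1)) = f (0 + u) := by
      rw [show 6 + (u + 1) = 0 + u + 7 by ring, hf]
    have h2 : ∀ i, i + (u + 1) = i + 1 + u := fun i => by ring
    rw [h1]
    simp only [h2]

theorem wt_per {a : F8} (ha : a ^ 3 = a + 1) (co : ℕ → ℕ → F8) (x : ℕ) :
    wt a co (x + 7) = wt a co x := by
  have h := fun y => (G_per ha co x y).1
  unfold wt
  exact Finset.sum_congr rfl fun y _ => by rw [h]

theorem wt_tr {a : F8} (ha : a ^ 3 = a + 1) (co : ℕ → ℕ → F8) (s : F8) (hs : s ≠ 0) (u v x : ℕ) :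
    wt a (tr a s u v co) x = wt a co (x + u) := by
  classical
  simp only [wt, G_tr, mul_eq_zero, hs, false_or]
  exact per_sum (fun y => if G a co (x + u) y = 0 then 0 else 1)
    (fun y => by simp only [(G_per ha co _ y).2]) v

theorem tot_tr {a : F8} (ha : a ^ 3 = a + 1) (co : ℕ → ℕ → F8) (s : F8) (hs : s ≠ 0) (u v : ℕ) :
    tot a (tr a s u v co) = tot a co := by
  simp only [tot, wt_tr ha co s hs]
  exact per_sum _ (wt_per ha co) u

theorem sum49 (f : ℕ → ℕ → ℕ) : ∑ x ∈ Finset.range 7, ∑ y ∈ Finset.range 7, f x y =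
    ∑ p ∈ Finset.range 49, f (p / 7) (p % 7) := by
  simp only [Finset.sum_range_succ, Finset.sum_range_zero]
  norm_num
  ring

theorem tot_ge {a : F8} (ha : a ^ 3 = a + 1) (co : ℕ → ℕ → F8) (o v : ℕ)
    (h : ∀ p < 49, G a co (p / 7) (p % 7) = val a o p + val a v p) (hag : agree o v ≤ 28) :
    21 ≤ tot a co := by
  classical
  have h1 : tot a co = ∑ p ∈ Finset.range 49, if G a co (p / 7) (p % 7) = 0 then 0 else 1 :=
    sum49 fun x y => if G a co x y = 0 then 0 else 1
  have h2 : tot a co + agree o v = 49 := by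
    rw [h1, agree, ← Finset.sum_add_distrib]
    have : ∑ p ∈ Finset.range 49, ((if G a co (p / 7) (p % 7) = 0 then 0 else 1) +
        (if dig v p = dig o p then 1 else 0)) = ∑ p ∈ Finset.range 49, 1 := by
      apply Finset.sum_congr rfl
      intro p hp
      have hiff : G a co (p / 7) (p % 7) = 0 ↔ dig v p = dig o p := by
        rw [h p (Finset.mem_range.1 hp)]
        constructor
        · intro h0
          apply phi_inj ha (dig_lt _ _) (dig_lt _ _)
          rw [phi_dig, phi_dig]
          have := two0 (val a v p)
          linear_combination this - h0
        · intro h0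
          rw [← phi_dig a o, ← phi_dig a v, h0, two0]
      by_cases hd : dig v p = dig o p
      · simp [hd, hiff.2 hd]
      · have hg : ¬ G a co (p / 7) (p % 7) = 0 := fun hc => hd (hiff.1 hc)
        rw [if_neg hd, if_neg hg]
    rw [this]
    simp
  omega

theorem tot_zero {a : F8} (co : ℕ → ℕ → F8)
    (h : ∀ p < 49, G a co (p / 7) (p % 7) = 0) : tot a co = 0 := by
  classical
  have h1 : tot a co = ∑ p ∈ Finset.range 49, if G a co (p / 7) (p % 7) = 0 then 0 else 1 :=
    sum49 fun x y => if G a co x y = 0 then 0 else 1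
  rw [h1]
  apply Finset.sum_eq_zero
  intro p hp
  rw [if_pos (h p (Finset.mem_range.1 hp))]

theorem supp3 : ∀ f : Fin 7 → Bool, (∑ i, if f i then 1 else 0) ≤ 3 →
    ∃ P ∈ trips.flatten, ∀ y : Fin 7, (y : ℕ) ∉ [P.1, P.2.1, P.2.2] → f y = false := by
  decide +kernel

theorem supp2 : ∀ f : Fin 7 → Bool, (∑ i, if f i then 1 else 0) ≤ 2 →
    ∃ P ∈ duos, ∀ y : Fin 7, (y : ℕ) ∉ [P.1, P.2] → f y = false := by
  decide +kernel

theorem supp1 : ∀ f : Fin 7 → Bool, (∑ i, if f i then 1 else 0) ≤ 1 →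
    ∃ q < 7, ∀ y : Fin 7, (y : ℕ) ≠ q → f y = false := by
  decide +kernel

open Classical in
theorem wt_fin (a : F8) (co : ℕ → ℕ → F8) (x : ℕ) :
    wt a co x = ∑ i : Fin 7, if (!decide (G a co x i = 0)) then 1 else 0 := by
  rw [wt, Finset.sum_range]
  apply Finset.sum_congr rfl
  intro i _
  by_cases h : G a co x i = 0 <;> simp [h]

theorem wt3 {a : F8} {co : ℕ → ℕ → F8} {x : ℕ} (h : wt a co x ≤ 3) :
    ∃ P ∈ trips.flatten, ∀ y < 7, y ∉ [P.1, P.2.1, P.2.2] → G a co x y = 0 := by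
  classical
  rw [wt_fin] at h
  obtain ⟨P, hP, h⟩ := supp3 _ h
  exact ⟨P, hP, fun y hy hn => by simpa using h ⟨y, hy⟩ hn⟩

theorem wt2 {a : F8} {co : ℕ → ℕ → F8} {x : ℕ} (h : wt a co x ≤ 2) :
    ∃ P ∈ duos, ∀ y < 7, y ∉ [P.1, P.2] → G a co x y = 0 := by
  classical
  rw [wt_fin] at h
  obtain ⟨P, hP, h⟩ := supp2 _ h
  exact ⟨P, hP, fun y hy hn => by simpa using h ⟨y, hy⟩ hn⟩

theorem wt1 {a : F8} {co : ℕ → ℕ → F8} {x : ℕ} (h : wt a co x ≤ 1) :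
    ∃ q, ∀ y < 7, y ≠ q → G a co x y = 0 := by
  classical
  rw [wt_fin] at h
  obtain ⟨q, hq, h⟩ := supp1 _ h
  exact ⟨q, fun y hy hn => by simpa using h ⟨y, hy⟩ hn⟩

theorem wt0 {a : F8} (ha : a ^ 3 = a + 1) {co : ℕ → ℕ → F8} {x : ℕ} (h : wt a co x = 0)
    (b : ℕ) (hb : b < 7) : H a co b x = 0 := by
  classical
  rw [wt, Finset.sum_eq_zero_iff] at h
  rw [← dft ha co x b hb]
  apply Finset.sum_eq_zero
  intro y hy
  have := h y hy
  simp only [ite_eq_left_iff, one_ne_zero, imp_false, not_not] at this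
  rw [this, mul_zero]

theorem wt_of_H {a : F8} {co : ℕ → ℕ → F8} {x : ℕ} (h : ∀ b ∈ rows5, H a co b x = 0)
    (h3 : H a co 3 x = 0) : wt a co x = 0 := by
  classical
  rw [wt, Finset.sum_eq_zero_iff]
  intro y _
  have : G a co x y = 0 := by
    rw [G, h 0 (by decide), h 1 (by decide), h 2 (by decide), h3, h 4 (by decide), h 5 (by decide)]
    ring
  simp [this]

/-! ### Words of columns -/

theorem val_colw {a : F8} (ha : a ^ 3 = a + 1) (h : ℕ → ℕ) (k l m p : ℕ) (hp : p < 49) :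
    val a (colw h k l m) p = phi a (h 0) * val a (WW 0 k l m) p + phi a (h 1) * val a (WW 1 k l m) p +
      phi a (h 2) * val a (WW 2 k l m) p + phi a (h 4) * val a (WW 4 k l m) p +
      phi a (h 5) * val a (WW 5 k l m) p := by
  simp only [colw, val_xor, val_smul ha _ _ _ hp]
  ring

theorem nodeD {a : F8} (ha : a ^ 3 = a + 1) {co : ℕ → ℕ → F8} (h33 : co 3 3 = 1) {k : ℕ} (l m : ℕ)
    {P : ℕ × ℕ} (hP : P ∈ duos) (h : ∀ y < 7, y ∉ [P.1, P.2] → G a co k y = 0) (p : ℕ) (hp : p < 49) :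
    N a co k l m p = val a (DWo k l m P) p := by
  have e (b : ℕ) (hb : b ∈ rows5) := duo_col ha co k hP h hb
  have h3 : H a co 3 k = a ^ (3 * k) := by simp [H, h33]
  rw [DWo, val_smul ha _ _ _ hp, val_colw ha _ _ _ _ _ hp, phi_pw ha, N, e 0 (by decide),
    e 1 (by decide), e 2 (by decide), e 4 (by decide), e 5 (by decide), h3]
  ring

theorem node0 {a : F8} (ha : a ^ 3 = a + 1) {co : ℕ → ℕ → F8} (h33 : co 3 3 = 1) (i j d : ℕ)
    (hd : d ∈ [1, 2, 3]) (h : ∀ y < 7, y ∉ [0, d] → G a co 0 y = 0) (p : ℕ) (hp : p < 49) :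
    N a co 0 i j p + co 3 3 * val a (EW 3 3) p = val a (base1 i j d) p := by
  have hP : ∀ d ∈ [1, 2, 3], (0, d) ∈ duos := by decide
  rw [nodeD ha h33 i j (hP d hd) h p hp, h33, base1, val_xor, DWo, val_smul ha _ _ _ hp, phi_pw ha]
  ring

theorem nodeT {a : F8} (ha : a ^ 3 = a + 1) {co : ℕ → ℕ → F8} {c s : ℕ} (h33 : phi a c = co 3 3)
    {k : ℕ} (l m : ℕ) (hs : phi a s = H a co 0 k) {P : ℕ × ℕ × ℕ} (hP : P ∈ trips.flatten)
    (h : ∀ y < 7, y ∉ [P.1, P.2.1, P.2.2] → G a co k y = 0) (p : ℕ) (hp : p < 49) :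
    N a co k l m p = phi a s * val a (AWo k l m P) p + val a (BWo c k l m P) p := by
  have e (b : ℕ) (hb : b ∈ rows5) := trip_col ha co k hP h hb
  have h3 : H a co 3 k = phi a c * a ^ (3 * k) := by simp [H, h33]
  rw [← hs] at e
  rw [AWo, BWo, val_smul ha _ _ _ hp, val_colw ha _ _ _ _ _ hp, val_colw ha _ _ _ _ _ hp,
    phi_smul ha, phi_pw ha, N, e 0 (by decide),
    e 1 (by decide), e 2 (by decide), e 4 (by decide), e 5 (by decide), h3]
  ring

theorem val_fw {a : F8} (ha : a ^ 3 = a + 1) (i j t0 t1 t2 p : ℕ) (hp : p < 49) :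
    val a (fw i j t0 t1 t2) p = phi a t0 * val a (TW 0 0 i j) p + phi a t1 * val a (TW 4 5 i j) p +
      phi a t2 * val a (TW 5 5 i j) p := by
  simp only [fw, val_xor, val_smul ha _ _ _ hp, val_0]
  ring

/-! ### The case of a nonzero coefficient at `(3, 3)` -/

theorem caseA {a : F8} (ha : a ^ 3 = a + 1) {co : ℕ → ℕ → F8} (h33 : co 3 3 = 1) {i j d : ℕ}
    (hij : (i, j) ∈ ijs) (hd : d ∈ [1, 2, 3]) (hc : chk 1 i j (base1 i j d) l8 = true)
    (h0 : ∀ y < 7, y ∉ [0, d] → G a co 0 y = 0) (hi : wt a co i ≤ 3) (hj : wt a co j ≤ 3) :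
    21 ≤ tot a co := by
  obtain ⟨P, hP, hPs⟩ := wt3 hi
  obtain ⟨Q, hQ, hQs⟩ := wt3 hj
  obtain ⟨s, hs, es⟩ := phi_surj ha (H a co 0 i)
  obtain ⟨t, ht, et⟩ := phi_surj ha (H a co 0 j)
  obtain ⟨t0, k0, e0⟩ := phi_surj ha (co 0 0)
  obtain ⟨t1, k1, e1⟩ := phi_surj ha (co 4 5)
  obtain ⟨t2, k2, e2⟩ := phi_surj ha (co 5 5)
  have h1 : phi a 1 = co 3 3 := by rw [h33]; simp [phi, Nat.testBit]
  refine tot_ge ha co _ _ ?_ (chk_spec hc hP hQ (mem_l8.2 hs) ht k0 k1 k2)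
  intro p hp
  have n0 := node0 ha h33 i j d hd h0 p hp
  have n1 := nodeT ha h1 0 j es hP hPs p hp
  have n2 := nodeT ha h1 0 i et hQ hQs p hp
  simp only [val_xor, val_smul ha _ _ _ hp, val_fw ha _ _ _ _ _ _ hp, e0, e1, e2]
  rw [decomp ha co hij p hp]
  linear_combination n0 + n1 + n2

theorem caseB {a : F8} (ha : a ^ 3 = a + 1) {co : ℕ → ℕ → F8} (h33 : co 3 3 = 1) {i j d : ℕ}
    (hij : (i, j) ∈ ijs) (hd : d ∈ [1, 2, 3]) (hc : chkB i j = true)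
    (h0 : ∀ y < 7, y ∉ [0, d] → G a co 0 y = 0) (hi : wt a co i ≤ 3) (hj : wt a co j ≤ 2) :
    21 ≤ tot a co := by
  obtain ⟨P, hP, hPs⟩ := wt3 hi
  obtain ⟨Q, hQ, hQs⟩ := wt2 hj
  obtain ⟨s, hs, es⟩ := phi_surj ha (H a co 0 i)
  obtain ⟨t0, k0, e0⟩ := phi_surj ha (co 0 0)
  obtain ⟨t1, k1, e1⟩ := phi_surj ha (co 4 5)
  obtain ⟨t2, k2, e2⟩ := phi_surj ha (co 5 5)
  have h1 : phi a 1 = co 3 3 := by rw [h33]; simp [phi, Nat.testBit]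
  refine tot_ge ha co _ _ ?_ (chkB_spec hc hd hP hQ hs k0 k1 k2)
  intro p hp
  have n0 := node0 ha h33 i j d hd h0 p hp
  have n1 := nodeT ha h1 0 j es hP hPs p hp
  have n2 := nodeD ha h33 0 i hQ hQs p hp
  simp only [val_xor, val_smul ha _ _ _ hp, val_fw ha _ _ _ _ _ _ hp, e0, e1, e2]
  rw [decomp ha co hij p hp]
  linear_combination n0 + n1 + n2

theorem caseC {a : F8} (ha : a ^ 3 = a + 1) {co : ℕ → ℕ → F8} (h33 : co 3 3 = 1) {i j d : ℕ}
    (hij : (i, j) ∈ ijs) (hd : d ∈ [1, 2, 3]) (hc : chkC i j = true)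
    (h0 : ∀ y < 7, y ∉ [0, d] → G a co 0 y = 0) (hi : wt a co i ≤ 2) (hj : wt a co j ≤ 2) :
    21 ≤ tot a co := by
  obtain ⟨P, hP, hPs⟩ := wt2 hi
  obtain ⟨Q, hQ, hQs⟩ := wt2 hj
  obtain ⟨t0, k0, e0⟩ := phi_surj ha (co 0 0)
  obtain ⟨t1, k1, e1⟩ := phi_surj ha (co 4 5)
  obtain ⟨t2, k2, e2⟩ := phi_surj ha (co 5 5)
  refine tot_ge ha co _ _ ?_ (chkC_spec hc hd hP hQ k0 k1 k2)
  intro p hp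
  have n0 := node0 ha h33 i j d hd h0 p hp
  have n1 := nodeD ha h33 0 j hP hPs p hp
  have n2 := nodeD ha h33 0 i hQ hQs p hp
  simp only [val_xor, val_fw ha _ _ _ _ _ _ hp, e0, e1, e2]
  rw [decomp ha co hij p hp]
  linear_combination n0 + n1 + n2

def Core1 (L : List ℕ) : Prop :=
  ∃ u ∈ List.range 7, L.getD (u % 7) 0 = 0 ∧
    ((L.getD ((u + 1) % 7) 0 ≤ 1 ∧ L.getD ((u + 3) % 7) 0 ≤ 1) ∨
    (L.getD ((u + 1) % 7) 0 ≤ 1 ∧ L.getD ((u + 2) % 7) 0 = 0) ∨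
    ∃ q ∈ [(1,2), (1,3), (1,4), (1,5), (2,4)],
      L.getD ((u + q.1) % 7) 0 = 0 ∧ L.getD ((u + q.2) % 7) 0 = 0)

instance : DecidablePred Core1 := fun L => by
  unfold Core1
  infer_instance

set_option synthInstance.maxSize 4096 in
set_option synthInstance.maxHeartbeats 0 in
theorem comb1_core : ∀ x0 < 3, ∀ x1 < 3, ∀ x2 < 3, ∀ x3 < 3, ∀ x4 < 3, ∀ x5 < 3, ∀ x6 < 3,
    x0 + x1 + x2 + x3 + x4 + x5 + x6 ≤ 6 → Core1 [x0, x1, x2, x3, x4, x5, x6] := by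
  decide +kernel

def Core2 (L : List ℕ) : Prop :=
  ∃ u ∈ List.range 7, L.getD (u % 7) 0 = 0 ∧
    ((∃ j ∈ [1, 2, 3], L.getD ((u + j) % 7) 0 = 0) ∨
    ∃ q ∈ [(1,2), (3,4), (5,6)],
      L.getD ((u + q.1) % 7) 0 = 1 ∧ L.getD ((u + q.2) % 7) 0 = 1)

instance : DecidablePred Core2 := fun L => by
  unfold Core2
  infer_instance

set_option synthInstance.maxSize 4096 in
set_option synthInstance.maxHeartbeats 0 in
theorem comb2_core : ∀ x0 < 3, ∀ x1 < 3, ∀ x2 < 3, ∀ x3 < 3, ∀ x4 < 3, ∀ x5 < 3, ∀ x6 < 3,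
    [0, 3, 4].getD x0 0 + [0, 3, 4].getD x1 0 + [0, 3, 4].getD x2 0 + [0, 3, 4].getD x3 0 +
      [0, 3, 4].getD x4 0 + [0, 3, 4].getD x5 0 + [0, 3, 4].getD x6 0 ≤ 20 →
    Core2 [x0, x1, x2, x3, x4, x5, x6] := by
  decide +kernel

theorem getD7 (f : ℕ → ℕ) (hf : ∀ x, f (x + 7) = f x) (n : ℕ) :
    [f 0, f 1, f 2, f 3, f 4, f 5, f 6].getD (n % 7) 0 = f n := by
  have h1 : f n = f (n % 7) := by
    conv_lhs => rw [← Nat.mod_add_div n 7]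
    generalize n % 7 = r
    induction n / 7 with
    | zero => rfl
    | succ k ih => rw [mul_add, ← add_assoc, mul_one, hf, ih]
  rw [h1]
  have := Nat.mod_lt n (show 0 < 7 by norm_num)
  generalize n % 7 = m at *
  interval_cases m <;> rfl

theorem comb1 (w : ℕ → ℕ) (hw : ∀ x, w (x + 7) = w x) (h2 : ∀ x, 2 ≤ w x)
    (hs : ∑ x ∈ Finset.range 7, w x ≤ 20) :
    ∃ u, w u ≤ 2 ∧ ((w (u + 1) ≤ 3 ∧ w (u + 3) ≤ 3) ∨ (w (u + 1) ≤ 3 ∧ w (u + 2) ≤ 2) ∨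
      ∃ q ∈ [(1,2), (1,3), (1,4), (1,5), (2,4)], w (u + q.1) ≤ 2 ∧ w (u + q.2) ≤ 2) := by
  have hl : ∀ x, min (w x - 2) 2 < 3 := fun x => by omega
  simp only [Finset.sum_range_succ, Finset.sum_range_zero] at hs
  have := h2 0; have := h2 1; have := h2 2; have := h2 3; have := h2 4; have := h2 5; have := h2 6
  have key := comb1_core _ (hl 0) _ (hl 1) _ (hl 2) _ (hl 3) _ (hl 4) _ (hl 5) _ (hl 6) (by omega)
  simp only [Core1, getD7 (fun x => min (w x - 2) 2) (fun x => by simp only [hw])] at key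
  obtain ⟨u, -, h0, h⟩ := key
  refine ⟨u, by omega, ?_⟩
  rcases h with ⟨h, h'⟩ | ⟨h, h'⟩ | ⟨q, hq, h, h'⟩
  · exact Or.inl ⟨by omega, by omega⟩
  · exact Or.inr (Or.inl ⟨by omega, by omega⟩)
  · exact Or.inr (Or.inr ⟨q, hq, by omega, by omega⟩)

theorem comb2 (w : ℕ → ℕ) (hw : ∀ x, w (x + 7) = w x) (h2 : ∀ x, w x = 0 ∨ 3 ≤ w x)
    (hs : ∑ x ∈ Finset.range 7, w x ≤ 20) :
    ∃ u, w u = 0 ∧ ((∃ j ∈ [1, 2, 3], w (u + j) = 0) ∨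
      ∃ q ∈ [(1,2), (3,4), (5,6)], w (u + q.1) = 3 ∧ w (u + q.2) = 3) := by
  have hl : ∀ x, min (w x - 2) 2 < 3 := fun x => by omega
  have hc : ∀ x, [0, 3, 4].getD (min (w x - 2) 2) 0 ≤ w x := by
    intro x
    rcases h2 x with h | h
    · simp [h]
    · rcases Nat.lt_or_ge (w x) 4 with h' | h'
      · rw [show w x = 3 by omega]; decide
      · rw [show min (w x - 2) 2 = 2 by omega]
        exact h'
  simp only [Finset.sum_range_succ, Finset.sum_range_zero] at hs
  have := hc 0; have := hc 1; have := hc 2; have := hc 3; have := hc 4; have := hc 5; have := hc 6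
  have key := comb2_core _ (hl 0) _ (hl 1) _ (hl 2) _ (hl 3) _ (hl 4) _ (hl 5) _ (hl 6) (by omega)
  simp only [Core2, getD7 (fun x => min (w x - 2) 2) (fun x => by simp only [hw])] at key
  obtain ⟨u, -, h0, h⟩ := key
  refine ⟨u, by have := h2 u; omega, ?_⟩
  rcases h with ⟨j, hj, h⟩ | ⟨q, hq, h, h'⟩
  · exact Or.inl ⟨j, hj, by have := h2 (u + j); omega⟩
  · exact Or.inr ⟨q, hq, by omega, by omega⟩

theorem shift_duo : ∀ P ∈ duos, ∃ v < 7, ∃ d ∈ [1, 2, 3], ∀ y < 7, y ∉ [0, d] →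
    (y + v) % 7 ∉ [P.1, P.2] := by
  decide +kernel

theorem G_mod {a : F8} (ha : a ^ 3 = a + 1) (co : ℕ → ℕ → F8) (x n : ℕ) :
    G a co x (n % 7) = G a co x n := by
  conv_rhs => rw [← Nat.mod_add_div n 7]
  generalize n % 7 = r
  induction n / 7 with
  | zero => rfl
  | succ k ih => rw [mul_add, ← add_assoc, mul_one, (G_per ha co x _).2, ← ih]

theorem norm1 {a : F8} (ha : a ^ 3 = a + 1) {co : ℕ → ℕ → F8} (h33 : co 3 3 ≠ 0) {u : ℕ}
    (hu : wt a co u ≤ 2) : ∃ co' : ℕ → ℕ → F8, ∃ d ∈ [1, 2, 3], co' 3 3 = 1 ∧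
      tot a co' = tot a co ∧ (∀ x, wt a co' x = wt a co (u + x)) ∧
      ∀ y < 7, y ∉ [0, d] → G a co' 0 y = 0 := by
  obtain ⟨P, hP, hPs⟩ := wt2 hu
  obtain ⟨v, -, d, hd, hv⟩ := shift_duo P hP
  have hne : co 3 3 * a ^ (3 * u + 3 * v) ≠ 0 := mul_ne_zero h33 (pow_ne_zero _ (ane ha))
  have hs : (co 3 3 * a ^ (3 * u + 3 * v))⁻¹ ≠ 0 := inv_ne_zero hne
  refine ⟨tr a (co 3 3 * a ^ (3 * u + 3 * v))⁻¹ u v co, d, hd, ?_, tot_tr ha co _ hs u v, ?_, ?_⟩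
  · rw [tr, mul_assoc, inv_mul_cancel₀ hne]
  · intro x
    rw [wt_tr ha co _ hs, add_comm]
  · intro y hy hn
    rw [G_tr, zero_add, ← G_mod ha, hPs _ (Nat.mod_lt _ (by norm_num)) (hv y hy hn), mul_zero]

theorem low1 {a : F8} (ha : a ^ 3 = a + 1) {co : ℕ → ℕ → F8} (h33 : co 3 3 ≠ 0) :
    21 ≤ tot a co := by
  by_contra hlt
  have h2 : ∀ x, 2 ≤ wt a co x := by
    intro x
    by_contra hx
    obtain ⟨q, hq⟩ := wt1 (a := a) (co := co) (x := x) (by omega)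
    have h := single_col ha co x q hq
    exact mul_ne_zero h33 (pow_ne_zero _ (ane ha)) h
  obtain ⟨u, hu, h⟩ := comb1 (wt a co) (wt_per ha co) h2 (by rw [tot] at hlt; omega)
  obtain ⟨co', d, hd, k33, ktot, kwt, k0⟩ := norm1 ha h33 hu
  apply hlt
  rw [← ktot]
  obtain ⟨⟨c1, c2, c3⟩, cB', ⟨cc1, cc2, cc3, cc4, cc5⟩, -, -⟩ := checks
  simp only [← kwt] at h
  rcases h with ⟨h, h'⟩ | ⟨h, h'⟩ | ⟨q, hq, h, h'⟩
  · have hc : ∀ d ∈ [1, 2, 3], chk 1 1 3 (base1 1 3 d) l8 = true := by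
      intro d hd
      simp only [List.mem_cons, List.not_mem_nil, or_false] at hd
      rcases hd with rfl | rfl | rfl
      · exact c1
      · exact c2
      · exact c3
    exact caseA ha k33 (by decide) hd (hc d hd) k0 h h'
  · exact caseB ha k33 (by decide) hd cB' k0 h h'
  · have hc : chkC q.1 q.2 = true ∧ q ∈ ijs := by
      simp only [List.mem_cons, List.not_mem_nil, or_false] at hq
      rcases hq with rfl | rfl | rfl | rfl | rfl
      · exact ⟨cc1, by decide⟩
      · exact ⟨cc2, by decide⟩
      · exact ⟨cc3, by decide⟩
      · exact ⟨cc4, by decide⟩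
      · exact ⟨cc5, by decide⟩
    exact caseC ha k33 hc.2 hd hc.1 k0 h h'

/-! ### The case of a zero coefficient at `(3, 3)` -/

theorem N_zero {a : F8} (ha : a ^ 3 = a + 1) {co : ℕ → ℕ → F8} {k : ℕ} (h : wt a co k = 0)
    (l m p : ℕ) : N a co k l m p = 0 := by
  have e := wt0 ha h
  rw [N, e 0 (by norm_num), e 1 (by norm_num), e 2 (by norm_num), e 4 (by norm_num),
    e 5 (by norm_num)]
  ring

theorem caseD {a : F8} (ha : a ^ 3 = a + 1) {co : ℕ → ℕ → F8} (h33 : co 3 3 = 0) {i j : ℕ}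
    (hij : (i, j) ∈ ijs) (hc : chk2 i j = true) (h0 : wt a co 0 = 0) (hj : wt a co j = 0)
    (hne : tot a co ≠ 0) : 21 ≤ tot a co := by
  obtain ⟨s0, l0, f0⟩ := phi_surj ha (H a co 0 i)
  obtain ⟨s1, l1, f1⟩ := phi_surj ha (H a co 1 i)
  obtain ⟨s2, l2, f2⟩ := phi_surj ha (H a co 2 i)
  obtain ⟨s4, l4, f4⟩ := phi_surj ha (H a co 4 i)
  obtain ⟨s5, l5, f5⟩ := phi_surj ha (H a co 5 i)
  obtain ⟨t0, k0, e0⟩ := phi_surj ha (co 0 0)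
  obtain ⟨t1, k1, e1⟩ := phi_surj ha (co 4 5)
  obtain ⟨t2, k2, e2⟩ := phi_surj ha (co 5 5)
  have hG : ∀ p < 49, G a co (p / 7) (p % 7) =
      val a (Nat.xor (smul s1 (WW 1 i 0 j)) (Nat.xor (smul s2 (WW 2 i 0 j)) (smul s4 (WW 4 i 0 j)))) p +
        val a (iw2 i j s0 s5 t0 t1 t2) p := by
    intro p hp
    rw [decomp ha co hij p hp, N_zero ha h0, N_zero ha hj, h33, N]
    simp only [iw2, val_xor, val_smul ha _ _ _ hp, val_0, e0, e1, e2, f0, f1, f2, f4, f5]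
    ring
  rcases chk2_spec hc l0 l1 l2 l4 l5 k0 k1 k2 with h | ⟨rfl, rfl, rfl, h⟩
  · exact tot_ge ha co _ _ hG h
  · exfalso
    apply hne
    apply tot_zero
    intro p hp
    have hz : phi a 0 = 0 := by simp [phi]
    rw [hG p hp, h, val_0]
    simp only [val_xor, val_smul ha _ _ _ hp, hz]
    ring

theorem caseE {a : F8} (ha : a ^ 3 = a + 1) {co : ℕ → ℕ → F8} (h33 : co 3 3 = 0) {i j : ℕ}
    (hij : (i, j) ∈ ijs) (hc : chk 0 i j 0 [1] = true) (h0 : wt a co 0 = 0)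
    (h1 : H a co 0 i = 1) (hi : wt a co i ≤ 3) (hj : wt a co j ≤ 3) : 21 ≤ tot a co := by
  obtain ⟨P, hP, hPs⟩ := wt3 hi
  obtain ⟨Q, hQ, hQs⟩ := wt3 hj
  have es : phi a 1 = H a co 0 i := by rw [h1]; simp [phi, Nat.testBit]
  have ec : phi a 0 = co 3 3 := by rw [h33]; simp [phi]
  obtain ⟨t, ht, et⟩ := phi_surj ha (H a co 0 j)
  obtain ⟨t0, k0, e0⟩ := phi_surj ha (co 0 0)
  obtain ⟨t1, k1, e1⟩ := phi_surj ha (co 4 5)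
  obtain ⟨t2, k2, e2⟩ := phi_surj ha (co 5 5)
  refine tot_ge ha co _ _ ?_ (chk_spec hc hP hQ (s := 1) (by simp) ht k0 k1 k2)
  intro p hp
  have n1 := nodeT ha ec 0 j es hP hPs p hp
  have n2 := nodeT ha ec 0 i et hQ hQs p hp
  simp only [val_xor, val_smul ha _ _ _ hp, val_fw ha _ _ _ _ _ _ hp, e0, e1, e2, val_0]
  rw [decomp ha co hij p hp, N_zero ha h0, h33]
  linear_combination n1 + n2

theorem caseE' {a : F8} (ha : a ^ 3 = a + 1) {co : ℕ → ℕ → F8} (h33 : co 3 3 = 0) {i j : ℕ}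
    (hij : (i, j) ∈ ijs) (hc : chk 0 i j 0 [1] = true) (h0 : wt a co 0 = 0)
    (hi : wt a co i = 3) (hj : wt a co j = 3) : 21 ≤ tot a co := by
  have h3 : H a co 3 i = 0 := by simp [H, h33]
  have hne : H a co 0 i ≠ 0 := by
    intro hz
    obtain ⟨P, hP, hPs⟩ := wt3 hi.le
    have : wt a co i = 0 := by
      apply wt_of_H _ h3
      intro b hb
      rw [trip_col ha co i hP hPs hb, hz, h3]
      ring
    omega
  have hs := inv_ne_zero hne
  rw [← tot_tr ha co _ hs 0 0]
  refine caseE ha (by simp [tr, h33]) hij hc ?_ ?_ ?_ ?_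
  · rw [wt_tr ha co _ hs]; exact h0
  · have : H a (tr a (H a co 0 i)⁻¹ 0 0 co) 0 i = (H a co 0 i)⁻¹ * H a co 0 i := by
      generalize (H a co 0 i)⁻¹ = z
      simp only [H, tr]
      ring
    rw [this, inv_mul_cancel₀ hne]
  · rw [wt_tr ha co _ hs]; exact hi.le
  · rw [wt_tr ha co _ hs]; exact hj.le

theorem low0 {a : F8} (ha : a ^ 3 = a + 1) {co : ℕ → ℕ → F8} (h33 : co 3 3 = 0)
    (hne : tot a co ≠ 0) : 21 ≤ tot a co := by
  by_contra hlt
  have h2 : ∀ x, wt a co x = 0 ∨ 3 ≤ wt a co x := by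
    intro x
    rcases Nat.lt_or_ge (wt a co x) 3 with h | h
    · left
      obtain ⟨P, hP, hPs⟩ := wt2 (a := a) (co := co) (x := x) (by omega)
      have h3 : H a co 3 x = 0 := by simp [H, h33]
      apply wt_of_H _ h3
      intro b hb
      rw [duo_col ha co x hP hPs hb, h3, mul_zero]
    · exact Or.inr h
  obtain ⟨u, hu, h⟩ := comb2 (wt a co) (wt_per ha co) h2 (by rw [tot] at hlt; omega)
  apply hlt
  have kwt : ∀ x, wt a (tr a 1 u 0 co) x = wt a co (u + x) := fun x => by
    rw [wt_tr ha co 1 one_ne_zero, add_comm]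
  have ktot := tot_tr ha co 1 one_ne_zero u 0
  have k33 : tr a 1 u 0 co 3 3 = 0 := by simp [tr, h33]
  have k0 : wt a (tr a 1 u 0 co) 0 = 0 := by rw [kwt]; exact hu
  rw [← ktot] at hne ⊢
  simp only [← kwt] at h
  obtain ⟨-, -, -, ⟨c1, c2, c3⟩, ⟨d1, d2, d3⟩⟩ := checks
  rcases h with ⟨j, hj, h⟩ | ⟨q, hq, h, h'⟩
  · simp only [List.mem_cons, List.not_mem_nil, or_false] at hj
    rcases hj with rfl | rfl | rfl
    · exact caseD ha k33 (by decide) d1 k0 h hne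
    · exact caseD ha k33 (by decide) d2 k0 h hne
    · exact caseD ha k33 (by decide) d3 k0 h hne
  · simp only [List.mem_cons, List.not_mem_nil, or_false] at hq
    rcases hq with rfl | rfl | rfl
    · exact caseE' ha k33 (by decide) c1 k0 h h'
    · exact caseE' ha k33 (by decide) c2 k0 h h'
    · exact caseE' ha k33 (by decide) c3 k0 h h'

theorem low {a : F8} (ha : a ^ 3 = a + 1) (co : ℕ → ℕ → F8) (hne : tot a co ≠ 0) :
    21 ≤ tot a co := by
  by_cases h : co 3 3 = 0
  · exact low0 ha h hne
  · exact low1 ha h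

end TC

namespace TC

/-! ### Transfer to the code -/

/-- the generator as a unit -/
noncomputable def ua {a : F8} (ha : a ^ 3 = a + 1) : F8ˣ := Units.mk0 a (ane ha)

theorem pw_surj : ∀ n < 8, n ≠ 0 → ∃ k < 7, pw k = n := by decide +kernel

theorem pw_inj : ∀ m < 7, ∀ n < 7, pw m = pw n → m = n := by decide +kernel

theorem bij {a : F8} (ha : a ^ 3 = a + 1) :
    Function.Bijective (fun n : Fin 7 => ua ha ^ (n : ℕ)) := by
  constructor
  · intro m n h
    have h1 : a ^ (m : ℕ) = a ^ (n : ℕ) := by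
      have := congrArg (fun u : F8ˣ => (u : F8)) h
      simpa [ua] using this
    rw [← phi_pw ha, ← phi_pw ha] at h1
    exact Fin.ext (pw_inj _ m.2 _ n.2 (phi_inj ha (pw_lt _) (pw_lt _) h1))
  · intro z
    obtain ⟨n, hn, e⟩ := phi_surj ha (z : F8)
    have h0 : n ≠ 0 := by
      rintro rfl
      exact z.ne_zero (by rw [← e, ← val_zero, val_0])
    obtain ⟨k, hk, rfl⟩ := pw_surj n hn h0
    refine ⟨⟨k, hk⟩, ?_⟩
    ext
    rw [← e, phi_pw ha]
    simp [ua]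

theorem weight {a : F8} (ha : a ^ 3 = a + 1) (co : ℕ → ℕ → F8) (c : F8ˣ × F8ˣ → F8)
    (hc : ∀ x y : ℕ, c (ua ha ^ x, ua ha ^ y) = G a co x y) :
    hammingWeight c = tot a co := by
  classical
  let e : Fin 7 ≃ F8ˣ := Equiv.ofBijective _ (bij ha)
  have h1 : Nat.card {p : Fin 7 × Fin 7 // G a co p.1 p.2 ≠ 0} = hammingWeight c := by
    apply Nat.card_congr
    refine (Equiv.prodCongr e e).subtypeEquiv ?_
    rintro ⟨x, y⟩
    rw [← hc]
    rfl
  rw [← h1, Nat.card_eq_fintype_card, Fintype.card_subtype, Finset.card_filter,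
    Fintype.sum_prod_type]
  unfold tot wt
  rw [← Fin.sum_univ_eq_sum_range (fun x => ∑ y ∈ Finset.range 7, if G a co x y = 0 then 0 else 1)]
  refine Finset.sum_congr rfl fun x _ => ?_
  rw [← Fin.sum_univ_eq_sum_range (fun y => if G a co x y = 0 then 0 else 1)]
  refine Finset.sum_congr rfl fun y _ => ?_
  by_cases h : G a co x y = 0
  · rw [if_pos h, if_neg (not_not.2 h)]
  · rw [if_neg h, if_pos h]

theorem coeffs {a : F8} (ha : a ^ 3 = a + 1) {c : F8ˣ × F8ˣ → F8}
    (hc : c ∈ Submodule.span F8 (evalVec '' S)) :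
    ∃ co : ℕ → ℕ → F8, ∀ x y : ℕ, c (ua ha ^ x, ua ha ^ y) = G a co x y := by
  induction hc using Submodule.span_induction with
  | mem c h =>
    obtain ⟨⟨i, j⟩, hij, rfl⟩ := h
    refine ⟨fun k l => if k = i ∧ l = j then 1 else 0, fun x y => ?_⟩
    simp only [S, Set.mem_insert_iff, Set.mem_singleton_iff, Prod.mk.injEq] at hij
    rcases hij with ⟨rfl, rfl⟩ | ⟨rfl, rfl⟩ | ⟨rfl, rfl⟩ | ⟨rfl, rfl⟩ | ⟨rfl, rfl⟩ | ⟨rfl, rfl⟩ |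
      ⟨rfl, rfl⟩ | ⟨rfl, rfl⟩ | ⟨rfl, rfl⟩ | ⟨rfl, rfl⟩ | ⟨rfl, rfl⟩ | ⟨rfl, rfl⟩ | ⟨rfl, rfl⟩ |
      ⟨rfl, rfl⟩ | ⟨rfl, rfl⟩ | ⟨rfl, rfl⟩ | ⟨rfl, rfl⟩ | ⟨rfl, rfl⟩ | ⟨rfl, rfl⟩ <;>
    · simp [evalVec, G, H, ua, ← pow_mul, mul_comm]
  | zero => exact ⟨fun _ _ => 0, fun x y => by simp [G, H]⟩
  | add c d _ _ hc hd =>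
    obtain ⟨co, h1⟩ := hc
    obtain ⟨co', h2⟩ := hd
    refine ⟨fun i j => co i j + co' i j, fun x y => ?_⟩
    rw [Pi.add_apply, h1, h2]
    simp only [G, H]
    ring
  | smul s c _ hc =>
    obtain ⟨co, h1⟩ := hc
    refine ⟨fun i j => s * co i j, fun x y => ?_⟩
    rw [Pi.smul_apply, h1, smul_eq_mul]
    simp only [G, H]
    ring

theorem tot_ne {a : F8} (ha : a ^ 3 = a + 1) (co : ℕ → ℕ → F8) {c : F8ˣ × F8ˣ → F8}
    (hc : ∀ x y : ℕ, c (ua ha ^ x, ua ha ^ y) = G a co x y) (hne : c ≠ 0) : tot a co ≠ 0 := by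
  rw [← weight ha co c hc]
  obtain ⟨p, hp⟩ := Function.ne_iff.1 hne
  have : Nonempty {p : F8ˣ × F8ˣ // c p ≠ 0} := ⟨⟨p, hp⟩⟩
  exact Nat.card_pos.ne'

/-! ### A word of weight 21 -/

theorem pat : ∀ x < 7, (Nat.xor (Nat.xor (Nat.xor (pw 0) (pw x)) (pw (2 * x))) (pw (5 * x)) < 8) ∧
    (decide (Nat.xor (Nat.xor (Nat.xor (pw 0) (pw x)) (pw (2 * x))) (pw (5 * x)) = 0) =
      [true, true, true, false, true, false, false].getD x true) := by decide +kernel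

theorem tot21 {a : F8} (ha : a ^ 3 = a + 1) :
    tot a (fun i j => if j = 5 ∧ (i = 0 ∨ i = 1 ∨ i = 2 ∨ i = 5) then 1 else 0) = 21 := by
  classical
  set co : ℕ → ℕ → F8 := fun i j => if j = 5 ∧ (i = 0 ∨ i = 1 ∨ i = 2 ∨ i = 5) then 1 else 0
    with hco
  have hG : ∀ x y, G a co x y =
      phi a (Nat.xor (Nat.xor (Nat.xor (pw 0) (pw x)) (pw (2 * x))) (pw (5 * x))) * a ^ (5 * y) := by
    intro x y
    simp only [phi_xor, phi_pw ha]
    simp [G, H, hco]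
  have hz : ∀ x < 7, ∀ y, G a co x y = 0 ↔
      [true, true, true, false, true, false, false].getD x true = true := by
    intro x hx y
    obtain ⟨p1, p2⟩ := pat x hx
    rw [← p2, decide_eq_true_iff, hG, mul_eq_zero]
    constructor
    · rintro (h | h)
      · exact phi_eq_zero ha p1 h
      · exact absurd h (pow_ne_zero _ (ane ha))
    · intro h
      left
      rw [h, ← val_zero, val_0]
  have hw : ∀ x < 7, wt a co x =
      if [true, true, true, false, true, false, false].getD x true = true then 0 else 7 := by
    intro x hx
    unfold wt
    split_ifs with h
    · exact Finset.sum_eq_zero fun y _ => if_pos ((hz x hx y).2 h)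
    · rw [Finset.sum_congr rfl fun y _ => if_neg fun hc => h ((hz x hx y).1 hc)]
      simp
  unfold tot
  rw [Finset.sum_congr rfl fun x hx => hw x (Finset.mem_range.1 hx)]
  decide

theorem word21 {a : F8} (ha : a ^ 3 = a + 1) (x y : ℕ) :
    (evalVec (0, 5) + evalVec (1, 5) + evalVec (2, 5) + evalVec (5, 5)) (ua ha ^ x, ua ha ^ y) =
    G a (fun i j => if j = 5 ∧ (i = 0 ∨ i = 1 ∨ i = 2 ∨ i = 5) then 1 else 0) x y := by
  simp [evalVec, G, H, ua]
  ring

end TC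

/-- The generalised toric code `C_S` over `F₈` has minimum distance exactly 21:
every nonzero codeword has Hamming weight at least 21, and some codeword has
Hamming weight exactly 21. -/
theorem min_dist :
    (∀ c ∈ Submodule.span F8 (evalVec '' S), c ≠ 0 → 21 ≤ hammingWeight c) ∧
    (∃ c ∈ Submodule.span F8 (evalVec '' S), hammingWeight c = 21) := by
  obtain ⟨a, ha⟩ := TC.exists_gen
  constructor
  · intro c hc hne
    obtain ⟨co, h⟩ := TC.coeffs ha hc
    rw [TC.weight ha co c h]
    exact TC.low ha co (TC.tot_ne ha co h hne)
  · refine ⟨evalVec (0, 5) + evalVec (1, 5) + evalVec (2, 5) + evalVec (5, 5), ?_, ?_⟩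
    · have h : ∀ p ∈ S, evalVec p ∈ Submodule.span F8 (evalVec '' S) := fun p hp =>
        Submodule.subset_span ⟨p, hp, rfl⟩
      exact add_mem (add_mem (add_mem (h _ (by simp [S])) (h _ (by simp [S]))) (h _ (by simp [S])))
        (h _ (by simp [S]))
    · rw [TC.weight ha _ _ (TC.word21 ha), TC.tot21 ha]
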